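/- arXiv:1501.07349 — 5 statements merged into one kernel-verified Lean document; each statement's English description precedes it below -/
import Mathlib

section
/- Let L ∈ ℝ^{n×n} be a graph Laplacian whose directed graph G(L) has a spanning tree, and let l_max = max_i l_ii (assume l_max > 0). Let δ ∈ (0, 1/2) and let t_0 < t_1 < t_2 < … be a sequence of update times with Δt_k := t_{k+1} − t_k satisfying δ/l_max ≤ Δt_k ≤ (1−δ)/l_max for every k. Let x : [t_0, ∞) → ℝ^n be continuous and satisfy the self-triggered dynamics ẋ(t) = −L x(t_k) for all t ∈ (t_k, t_{k+1}) and all k. Then the system reaches consensus: there exists x* ∈ ℝ such that lim_{t→∞} x_i(t) = x* for every i = 1, …, n. -/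
open Filter Topology

/-- A directed graph (given by its edge relation) has a spanning tree:
there is a root from which every vertex is reachable by a directed path. -/
def HasSpanningTreeRel {V : Type*} (edge : V → V → Prop) : Prop :=
  ∃ r : V, ∀ v : V, Relation.ReflTransGen edge r v

/-- `L` is a graph Laplacian: nonpositive off-diagonal entries and zero row sums
(equivalently, `l_ii = -∑_{j ≠ i} l_ij`). -/
def IsLaplacian {n : ℕ} (L : Fin n → Fin n → ℝ) : Prop :=
  (∀ i j, i ≠ j → L i j ≤ 0) ∧ ∀ i, ∑ j, L i j = 0

/-- A row-stochastic Euler step `w ↦ w - τ L w` keeps every entry above a lower bound `m` of `w`,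
with the excess of any entry of `w` transmitted with its weight. -/
theorem IsLaplacian.lower_bound_step {n : ℕ} {L : Fin n → Fin n → ℝ} (hL : IsLaplacian L)
    {τ : ℝ} (hτ : 0 ≤ τ) {i : Fin n} (hi : τ * L i i ≤ 1) {w : Fin n → ℝ} {m : ℝ}
    (hm : ∀ j, m ≤ w j) (j : Fin n) :
    m + ((if i = j then 1 else 0) - τ * L i j) * (w j - m) ≤ w i - τ * ∑ l, L i l * w l := by
  have key : w i - τ * ∑ l, L i l * w l - m =
      ∑ l, ((if i = l then 1 else 0) - τ * L i l) * (w l - m) := by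
    have h : ∑ l, L i l * (w l - m) = ∑ l, L i l * w l := by
      simp only [mul_sub, Finset.sum_sub_distrib, ← Finset.sum_mul, hL.2 i]
      ring
    simp only [sub_mul, Finset.sum_sub_distrib, mul_assoc, ← Finset.mul_sum, h]
    simp
    ring
  have hle : ((if i = j then 1 else 0) - τ * L i j) * (w j - m) ≤
      ∑ l, ((if i = l then 1 else 0) - τ * L i l) * (w l - m) := by
    refine Finset.single_le_sum (f := fun l => ((if i = l then 1 else 0) - τ * L i l) * (w l - m))
      (fun l _ => mul_nonneg ?_ (sub_nonneg.2 (hm l))) (Finset.mem_univ j)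
    split_ifs with hil
    · subst hil
      linarith
    · nlinarith [hL.1 i l hil]
  linarith

/-- Finitely many positive weights have a common positive lower bound. -/
theorem exists_pos_le_weights {n : ℕ} (L : Fin n → Fin n → ℝ) {δ c : ℝ} (hδ : 0 < δ)
    (hc : 0 < c) : ∃ η, 0 < η ∧ η ≤ δ ∧ ∀ i j, L i j < 0 → η ≤ c * -L i j := by
  have h : ∀ᶠ η in 𝓝[>] (0 : ℝ), 0 < η ∧ η ≤ δ ∧ ∀ i j, L i j < 0 → η ≤ c * -L i j := by
    have hle : ∀ a : ℝ, 0 < a → ∀ᶠ η in 𝓝[>] (0 : ℝ), η ≤ a := fun a ha =>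
      nhdsWithin_le_nhds (Iic_mem_nhds ha)
    refine eventually_mem_nhdsWithin.and ((hle δ hδ).and ?_)
    refine eventually_all.2 fun i => eventually_all.2 fun j => ?_
    by_cases hij : L i j < 0
    · filter_upwards [hle _ (mul_pos hc (neg_pos.2 hij))] with η hη _ using hη
    · exact Eventually.of_forall fun η hη => absurd hη hij
  exact h.exists

/-- `z` spreads excess over lower bounds along the relation `edge` with factor `η`. -/
def SpreadsExcess {V : Type*} (edge : V → V → Prop) (η : ℝ) (z : ℕ → V → ℝ) : Prop :=
  ∀ k m, (∀ i, m ≤ z k i) → ∀ i j, j = i ∨ edge j i → m + η * (z k j - m) ≤ z (k + 1) i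

namespace SpreadsExcess

variable {V : Type*} {edge : V → V → Prop} {η : ℝ} {z : ℕ → V → ℝ}

theorem lower_bound_add (hz : SpreadsExcess edge η z) (hη : 0 ≤ η) {k : ℕ} {m : ℝ}
    (hm : ∀ i, m ≤ z k i) (d : ℕ) (i : V) : m ≤ z (k + d) i := by
  induction d generalizing i with
  | zero => exact hm i
  | succ d ih =>
    have := hz (k + d) m ih i i (.inl rfl)
    have := mul_nonneg hη (sub_nonneg.2 (ih i))
    rw [← add_assoc]
    linarith

theorem excess_succ (hz : SpreadsExcess edge η z) (hη : 0 ≤ η) {k d : ℕ} {m a : ℝ}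
    (hm : ∀ i, m ≤ z k i) {i j : V} (hij : j = i ∨ edge j i)
    (h : m + η ^ d * a ≤ z (k + d) j) : m + η ^ (d + 1) * a ≤ z (k + (d + 1)) i := by
  have h1 := hz (k + d) m (hz.lower_bound_add hη hm d) i j hij
  have h2 := mul_le_mul_of_nonneg_left (le_sub_iff_add_le'.2 h) hη
  rw [pow_succ', mul_assoc, ← add_assoc]
  linarith

theorem exists_excess_of_reachable {r v : V} (h : Relation.ReflTransGen edge r v) (hη : 0 ≤ η) :
    ∃ N, ∀ z, SpreadsExcess edge η z → ∀ d ≥ N, ∀ k m, (∀ i, m ≤ z k i) →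
      m + η ^ d * (z k r - m) ≤ z (k + d) v := by
  induction h with
  | refl =>
    refine ⟨0, fun z hz d _ k m hm => ?_⟩
    induction d with
    | zero => simp
    | succ d ih => exact hz.excess_succ hη hm (.inl rfl) (ih (Nat.zero_le d))
  | tail _ hbc ih =>
    obtain ⟨N, hN⟩ := ih
    refine ⟨N + 1, fun z hz d hd k m hm => ?_⟩
    obtain ⟨d, rfl⟩ : ∃ e, d = e + 1 := ⟨d - 1, by omega⟩
    exact hz.excess_succ hη hm (.inr hbc) (hN z hz d (by omega) k m hm)

theorem exists_excess [Finite V] {r : V} (h : ∀ v, Relation.ReflTransGen edge r v)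
    (hη : 0 ≤ η) :
    ∃ N, ∀ z, SpreadsExcess edge η z → ∀ k m, (∀ i, m ≤ z k i) →
      ∀ v, m + η ^ N * (z k r - m) ≤ z (k + N) v := by
  choose N hN using fun v => exists_excess_of_reachable (h v) hη
  obtain ⟨B, hB⟩ := (Set.finite_range N).bddAbove
  exact ⟨B, fun z hz k m hm v => hN v z hz B (hB ⟨v, rfl⟩) k m hm⟩

/-- If excess over lower bounds and under upper bounds both spread from a root,
the entries are eventually confined to arbitrarily short intervals. -/
theorem exists_short_interval [Finite V] (hroot : HasSpanningTreeRel edge) (hη : 0 < η)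
    (hη1 : η ≤ 1) (hz : SpreadsExcess edge η z) (hz' : SpreadsExcess edge η (-z))
    {ε : ℝ} (hε : 0 < ε) : ∃ k a b, b - a < ε ∧ ∀ i, a ≤ z k i ∧ z k i ≤ b := by
  obtain ⟨r, hr⟩ := hroot
  obtain ⟨N, hN⟩ := exists_excess hr hη.le
  obtain ⟨a₀, ha₀⟩ := (Set.finite_range (z 0)).bddBelow
  obtain ⟨b₀, hb₀⟩ := (Set.finite_range (z 0)).bddAbove
  have step : ∀ p : ℕ, ∃ k a b, b - a = (1 - η ^ N) ^ p * (b₀ - a₀) ∧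
      ∀ i, a ≤ z k i ∧ z k i ≤ b := by
    intro p
    induction p with
    | zero => exact ⟨0, a₀, b₀, by simp, fun i => ⟨ha₀ ⟨i, rfl⟩, hb₀ ⟨i, rfl⟩⟩⟩
    | succ p ih =>
      obtain ⟨k, a, b, hab, h⟩ := ih
      refine ⟨k + N, a + η ^ N * (z k r - a), b - η ^ N * (b - z k r), ?_, fun i => ⟨?_, ?_⟩⟩
      · rw [pow_succ', mul_assoc, ← hab]
        ring
      · exact hN z hz k a (fun i => (h i).1) i
      · have := hN (-z) hz' k (-b) (fun i => neg_le_neg (h i).2) i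
        simp only [Pi.neg_apply] at this
        linarith
  have hc : Tendsto (fun p : ℕ => (1 - η ^ N) ^ p * (b₀ - a₀)) atTop (𝓝 0) := by
    have := (tendsto_pow_atTop_nhds_zero_of_lt_one (sub_nonneg.2 (pow_le_one₀ hη.le hη1))
      (sub_lt_self 1 (pow_pos hη N))).mul_const (b₀ - a₀)
    rwa [zero_mul] at this
  obtain ⟨p, hp⟩ := (hc.eventually (gt_mem_nhds hε)).exists
  obtain ⟨k, a, b, hab, h⟩ := step p
  exact ⟨k, a, b, hab ▸ hp, h⟩

end SpreadsExcess

/-- Functions that are eventually confined to arbitrarily short common intervals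
have a common limit. -/
theorem exists_common_limit {V : Type*} [Nonempty V] {x : ℝ → V → ℝ}
    (h : ∀ ε > 0, ∃ T a b : ℝ, b - a < ε ∧ ∀ u ≥ T, ∀ i, a ≤ x u i ∧ x u i ≤ b) :
    ∃ xs : ℝ, ∀ i, Tendsto (fun u => x u i) atTop (𝓝 xs) := by
  obtain ⟨r⟩ := ‹Nonempty V›
  have hr : CauchySeq fun u => x u r := by
    refine Metric.cauchySeq_iff'.2 fun ε hε => ?_
    obtain ⟨T, a, b, hab, hT⟩ := h ε hε
    refine ⟨T, fun u hu => ?_⟩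
    rw [Real.dist_eq, abs_lt]
    constructor <;> linarith [hT u hu r, hT T le_rfl r]
  obtain ⟨xs, hxs⟩ := cauchySeq_tendsto_of_complete hr
  refine ⟨xs, fun i => Metric.tendsto_atTop.2 fun ε hε => ?_⟩
  obtain ⟨T, a, b, hab, hT⟩ := h ε hε
  have ha : a ≤ xs := ge_of_tendsto hxs ((eventually_ge_atTop T).mono fun u hu => (hT u hu r).1)
  have hb : xs ≤ b := le_of_tendsto hxs ((eventually_ge_atTop T).mono fun u hu => (hT u hu r).2)
  refine ⟨T, fun u hu => ?_⟩
  rw [Real.dist_eq, abs_lt]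
  constructor <;> linarith [hT u hu i]

/-- A continuous function with constant derivative inside an interval is affine on it. -/
theorem eq_add_mul_of_hasDerivAt_Ioo {f : ℝ → ℝ} (hf : Continuous f) {a b c : ℝ}
    (h : ∀ s ∈ Set.Ioo a b, HasDerivAt f c s) {u : ℝ} (hu : u ∈ Set.Icc a b) :
    f u = f a + (u - a) * c := by
  rcases hu.1.eq_or_lt with rfl | hau
  · simp
  · obtain ⟨s, -, hs⟩ := exists_hasDerivAt_eq_slope f (fun _ => c) hau hf.continuousOn
      fun s hs => h s ⟨hs.1, hs.2.trans_le hu.2⟩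
    have : u - a ≠ 0 := (sub_pos.2 hau).ne'
    rw [hs]
    field_simp
    ring

/-- Steps bounded below by a positive constant exhaust the half-line. -/
theorem exists_le_add_of_step_ge {t : ℕ → ℝ} {c : ℝ} (hc : 0 < c)
    (h : ∀ k, c ≤ t (k + 1) - t k) (k : ℕ) (u : ℝ) : ∃ d, u ≤ t (k + d) := by
  have hlin : ∀ d : ℕ, t k + d * c ≤ t (k + d) := by
    intro d
    induction d with
    | zero => simp
    | succ d ih =>
      have := h (k + d)
      rw [← add_assoc]
      push_cast
      linarith
  obtain ⟨d, hd⟩ := exists_nat_ge ((u - t k) / c)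
  exact ⟨d, by linarith [hlin d, (div_le_iff₀ hc).1 hd]⟩

/-- Theorem 1, centralized self-triggered consensus, fixed topology. -/
theorem centralized_selfTriggered_consensus
    {n : ℕ} (L : Fin n → Fin n → ℝ) (hL : IsLaplacian L)
    (htree : HasSpanningTreeRel (fun j i : Fin n => i ≠ j ∧ L i j < 0))
    (lmax : ℝ) (hmax : IsGreatest (Set.range fun i => L i i) lmax)
    (hpos : 0 < lmax)
    (δ : ℝ) (hδ : δ ∈ Set.Ioo (0 : ℝ) (1 / 2))
    (t : ℕ → ℝ) (hmono : StrictMono t)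
    (hΔ : ∀ k, t (k + 1) - t k ∈ Set.Icc (δ / lmax) ((1 - δ) / lmax))
    (x : ℝ → Fin n → ℝ) (hcont : Continuous x)
    (hdyn : ∀ k, ∀ s ∈ Set.Ioo (t k) (t (k + 1)), ∀ i,
      HasDerivAt (fun u => x u i) (-∑ j, L i j * x (t k) j) s) :
    ∃ xs : ℝ, ∀ i, Tendsto (fun u => x u i) atTop (𝓝 xs) := by
  obtain ⟨hδ0, hδ1⟩ := hδ
  have hc : 0 < δ / lmax := div_pos hδ0 hpos
  have hLmax : ∀ i, L i i ≤ lmax := fun i => hmax.2 ⟨i, rfl⟩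
  have hΔmul : ∀ k, (t (k + 1) - t k) * lmax ≤ 1 - δ := fun k => (le_div_iff₀ hpos).1 (hΔ k).2
  have hweight : ∀ k i, ∀ u ∈ Set.Icc (t k) (t (k + 1)), (u - t k) * L i i ≤ 1 - δ := by
    intro k i u hu
    have h1 := mul_le_mul_of_nonneg_left (hLmax i) (sub_nonneg.2 hu.1)
    have h2 := mul_le_mul_of_nonneg_right (sub_le_sub_right hu.2 (t k)) hpos.le
    linarith [hΔmul k]
  have hsol : ∀ k i, ∀ u ∈ Set.Icc (t k) (t (k + 1)),
      x u i = x (t k) i - (u - t k) * ∑ j, L i j * x (t k) j := by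
    intro k i u hu
    have := eq_add_mul_of_hasDerivAt_Ioo ((continuous_apply i).comp hcont)
      (fun s hs => hdyn k s hs i) hu
    simp only [Function.comp_apply] at this
    linarith
  obtain ⟨η, hη, hηδ, hηL⟩ := exists_pos_le_weights L hδ0 hc
  have hmem : ∀ k, t (k + 1) ∈ Set.Icc (t k) (t (k + 1)) := fun k =>
    ⟨(hmono k.lt_succ_self).le, le_rfl⟩
  have hspread : ∀ z : ℕ → Fin n → ℝ,
      (∀ k i, z (k + 1) i = z k i - (t (k + 1) - t k) * ∑ j, L i j * z k j) →
      SpreadsExcess (fun j i : Fin n => i ≠ j ∧ L i j < 0) η z := by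
    intro z hz k m hm i j hij
    rw [hz]
    have hwi := hweight k i _ (hmem k)
    have hstep := hL.lower_bound_step (sub_nonneg.2 (hmem k).1) (by linarith) hm j (i := i)
    refine le_trans ?_ hstep
    gcongr
    · exact sub_nonneg.2 (hm j)
    rcases hij with rfl | ⟨hij, hneg⟩
    · rw [if_pos rfl]
      linarith
    · have := mul_le_mul_of_nonneg_right (hΔ k).1 (neg_pos.2 hneg).le
      rw [if_neg hij]
      linarith [hηL i j hneg]
  have hspread_pos := hspread (fun k => x (t k)) fun k i => hsol k i _ (hmem k)
  have hspread_neg := hspread (-fun k => x (t k)) fun k i => by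
    simp only [Pi.neg_apply, hsol k i _ (hmem k), mul_neg, Finset.sum_neg_distrib]
    ring
  have hstay : ∀ k a b, (∀ i, a ≤ x (t k) i ∧ x (t k) i ≤ b) →
      ∀ u ∈ Set.Icc (t k) (t (k + 1)), ∀ i, a ≤ x u i ∧ x u i ≤ b := by
    intro k a b h u hu i
    have hwi := hweight k i u hu
    have hτ := sub_nonneg.2 hu.1
    have hcoef : 0 ≤ 1 - (u - t k) * L i i := by linarith
    have hlow := hL.lower_bound_step hτ (by linarith) (fun j => (h j).1) i (i := i)
    have hupp := hL.lower_bound_step hτ (by linarith) (fun j => neg_le_neg (h j).2) i (i := i)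
    have h1 := mul_nonneg hcoef (sub_nonneg.2 (h i).1)
    have h2 := mul_nonneg hcoef (sub_nonneg.2 (h i).2)
    simp only [if_true, mul_neg, Finset.sum_neg_distrib] at hlow hupp
    rw [hsol k i u hu]
    constructor <;> linarith
  have hstay_add : ∀ k a b, (∀ i, a ≤ x (t k) i ∧ x (t k) i ≤ b) →
      ∀ d, ∀ u ∈ Set.Icc (t k) (t (k + d)), ∀ i, a ≤ x u i ∧ x u i ≤ b := by
    intro k a b h d
    induction d with
    | zero =>
      intro u hu
      rwa [le_antisymm hu.2 hu.1]
    | succ d ih =>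
      intro u hu
      rcases le_total u (t (k + d)) with hud | hud
      · exact ih u ⟨hu.1, hud⟩
      · exact hstay (k + d) a b (ih _ ⟨hmono.monotone (Nat.le_add_right k d), le_rfl⟩) u
          ⟨hud, hu.2⟩
  have : Nonempty (Fin n) := ⟨htree.choose⟩
  refine exists_common_limit fun ε hε => ?_
  obtain ⟨k, a, b, hab, h⟩ := SpreadsExcess.exists_short_interval htree hη
    (by linarith) hspread_pos hspread_neg hε
  refine ⟨t k, a, b, hab, fun u hu => ?_⟩
  obtain ⟨d, hd⟩ := exists_le_add_of_step_ge hc (fun k => (hΔ k).1) k u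
  exact hstay_add k a b h d u ⟨hu, hd⟩
end

section
/- Let L ∈ ℝ^{n×n} be a graph Laplacian whose directed graph G(L) has a spanning tree and with l_ii > 0 for every i. For each agent i let δ_i ∈ (0, 1/2) and let t_i^0 < t_i^1 < t_i^2 < … be its update times with Δt_i^k := t_i^{k+1} − t_i^k ∈ [δ_i/l_ii, (1−δ_i)/l_ii] for all k. For t ≥ max_i t_i^0 set k_j(t) = max{k : t_j^k ≤ t}. Let x : ℝ → ℝ^n be continuous and satisfy the distributed self-triggered dynamics ẋ_i(t) = −∑_{j=1}^n l_ij x_j(t_j^{k_j(t)}) for every i and every t that is not an update time of any agent. Then the system reaches consensus: there exists x* ∈ ℝ such that lim_{t→∞} x_i(t) = x* for every i. -/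
open Filter Topology

/-- A solution of the distributed self-triggered consensus dynamics on `[T₀, ∞)`, where `h` bounds
the time between consecutive updates of any agent. -/
structure SelfTriggered {n : ℕ} (L : Fin n → Fin n → ℝ) (δ : Fin n → ℝ) (t : Fin n → ℕ → ℝ)
    (K : Fin n → ℝ → ℕ) (T₀ h : ℝ) (x : ℝ → Fin n → ℝ) : Prop where
  laplacian : IsLaplacian L
  diag_pos : ∀ i, 0 < L i i
  delta_pos : ∀ i, 0 < δ i
  strictMono : ∀ i, StrictMono (t i)
  delta_le : ∀ i k, δ i ≤ L i i * (t i (k + 1) - t i k)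
  le_one_sub_delta : ∀ i k, L i i * (t i (k + 1) - t i k) ≤ 1 - δ i
  gap_le : ∀ i k, t i (k + 1) - t i k ≤ h
  cont : Continuous x
  start_le : ∀ i, t i 0 ≤ T₀
  last_le : ∀ j s, T₀ ≤ s → t j (K j s) ≤ s
  le_last : ∀ j s k, T₀ ≤ s → t j k ≤ s → k ≤ K j s
  dyn : ∀ s, T₀ ≤ s → (∀ i k, s ≠ t i k) → ∀ i,
    HasDerivAt (fun u => x u i) (-∑ j, L i j * x (t j (K j s)) j) s

namespace SelfTriggered

variable {n : ℕ} {L : Fin n → Fin n → ℝ} {δ : Fin n → ℝ} {t : Fin n → ℕ → ℝ}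
  {K : Fin n → ℝ → ℕ} {T₀ h : ℝ} {x : ℝ → Fin n → ℝ}

theorem neg (S : SelfTriggered L δ t K T₀ h x) : SelfTriggered L δ t K T₀ h (-x) where
  __ := S
  cont := S.cont.neg
  dyn s hs hne i := by
    have hsum : -∑ j, L i j * (-x) (t j (K j s)) j = -(-∑ j, L i j * x (t j (K j s)) j) := by
      simp [Finset.sum_neg_distrib]
    rw [hsum]
    exact (S.dyn s hs hne i).neg

theorem lt_next (S : SelfTriggered L δ t K T₀ h x) (j : Fin n) {s : ℝ} (hs : T₀ ≤ s) :
    s < t j (K j s + 1) := by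
  by_contra! hc
  have := S.le_last j s _ hs hc
  omega

theorem last_mono (S : SelfTriggered L δ t K T₀ h x) (j : Fin n) {u s : ℝ} (hu : T₀ ≤ u)
    (hus : u ≤ s) : K j u ≤ K j s :=
  S.le_last j s _ (hu.trans hus) ((S.last_le j u hu).trans hus)

theorem last_eq (S : SelfTriggered L δ t K T₀ h x) {j : Fin n} {s : ℝ} {k : ℕ} (hs : T₀ ≤ s)
    (h₁ : t j k ≤ s) (h₂ : s < t j (k + 1)) : K j s = k := by
  refine le_antisymm ?_ (S.le_last j s k hs h₁)
  have := (S.strictMono j).lt_iff_lt.1 ((S.last_le j s hs).trans_lt h₂)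
  omega

theorem sub_lt_last (S : SelfTriggered L δ t K T₀ h x) (j : Fin n) {s : ℝ} (hs : T₀ ≤ s) :
    s - h < t j (K j s) := by
  have := S.lt_next j hs
  have := S.gap_le j (K j s)
  linarith

/-- After `T₀ + h` the latest update of an agent has a predecessor. -/
theorem exists_last_eq_succ (S : SelfTriggered L δ t K T₀ h x) (j : Fin n) {s : ℝ}
    (hh : 0 ≤ h) (hs : T₀ + h ≤ s) : ∃ k, K j s = k + 1 := by
  refine Nat.exists_eq_succ_of_ne_zero fun h0 => ?_
  have := S.sub_lt_last j (s := s) (by linarith)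
  rw [h0] at this
  have := S.start_le j
  linarith

theorem hasDerivWithinAt (S : SelfTriggered L δ t K T₀ h x) (i : Fin n) {s : ℝ} (hs : T₀ ≤ s) :
    HasDerivWithinAt (fun u => x u i) (-∑ j, L i j * x (t j (K j s)) j) (Set.Ici s) s := by
  have hev : ∀ᶠ u in 𝓝[>] s, ∀ j, u < t j (K j s + 1) :=
    eventually_all.2 fun j =>
      mem_nhdsWithin_of_mem_nhds (Iio_mem_nhds (S.lt_next j hs))
  obtain ⟨v, hv, hsub⟩ := (mem_nhdsGT_iff_exists_Ioo_subset).1 hev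
  have hK : ∀ u ∈ Set.Ioo s v, ∀ j, K j u = K j s := fun u hu j =>
    S.last_eq (hs.trans hu.1.le) ((S.last_le j s hs).trans hu.1.le) (hsub hu j)
  have hd : ∀ u ∈ Set.Ioo s v,
      HasDerivAt (fun u => x u i) (-∑ j, L i j * x (t j (K j s)) j) u := fun u hu => by
    have := S.dyn u (hs.trans hu.1.le) (fun j k huk => by
      have h1 := S.le_last j u k (hs.trans hu.1.le) huk.ge
      rw [hK u hu j] at h1
      have h2 := (S.strictMono j).monotone h1
      have h3 := S.last_le j s hs
      linarith [hu.1]) i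
    simpa only [hK u hu] using this
  refine hasDerivWithinAt_Ici_of_tendsto_deriv (s := Set.Ioo s v)
    (fun u hu => (hd u hu).differentiableAt.differentiableWithinAt)
    ((continuous_apply i).comp S.cont).continuousWithinAt (Ioo_mem_nhdsGT hv) ?_
  refine tendsto_const_nhds.congr' ?_
  filter_upwards [Ioo_mem_nhdsGT hv] with u hu using (hd u hu).deriv.symm

theorem sum_le (S : SelfTriggered L δ t K T₀ h x) {i w : Fin n} {y : Fin n → ℝ} {M η : ℝ}
    (hy : ∀ j, y j ≤ M) (hw : y w ≤ M - η) (hwi : w ≠ i ∨ η = 0) :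
    -∑ j, L i j * y j ≤ L i i * (M - y i) + L i w * η := by
  have hsum : -∑ j, L i j * y j = ∑ j, L i j * (M - y j) := by
    simp only [mul_sub, Finset.sum_sub_distrib, ← Finset.sum_mul, S.laplacian.2 i]
    ring
  have hrhs : L i i * (M - y i) + L i w * η =
      ∑ j, ((if j = i then L i j * (M - y j) else 0) + if j = w then L i j * η else 0) := by
    simp [Finset.sum_add_distrib]
  rw [hsum, hrhs]
  refine Finset.sum_le_sum fun j _ => ?_
  have hj := hy j
  by_cases hji : j = i
  · rcases hwi with hwi | rfl
    · rw [if_pos hji, if_neg (hji ▸ hwi.symm), add_zero]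
    · simp [hji]
  · have hL := S.laplacian.1 i j (Ne.symm hji)
    rw [if_neg hji, zero_add]
    split_ifs with hjw
    · subst hjw
      exact mul_le_mul_of_nonpos_left (by linarith) hL
    · exact mul_nonpos_of_nonpos_of_nonneg hL (by linarith)

/-- Between two updates of agent `i`, its distance to an upper bound `M` of all held values shrinks
at most linearly, and gains from a neighbour `w` that stays `η` below `M`. -/
theorem le_gap (S : SelfTriggered L δ t K T₀ h x) {i w : Fin n} {k : ℕ} {s M η : ℝ}
    (hk : T₀ ≤ t i k) (hks : t i k ≤ s) (hsk : s ≤ t i (k + 1))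
    (hM : ∀ u ∈ Set.Ico (t i k) s, ∀ j, x (t j (K j u)) j ≤ M)
    (hw : ∀ u ∈ Set.Ico (t i k) s, x (t w (K w u)) w ≤ M - η) (hwi : w ≠ i ∨ η = 0) :
    (1 - L i i * (s - t i k)) * (M - x (t i k) i) - L i w * η * (s - t i k) ≤ M - x s i := by
  set C := L i i * (M - x (t i k) i) + L i w * η with hC
  have key := image_le_of_deriv_right_le_deriv_boundary (a := t i k) (b := s)
    (f := fun u => x u i) (f' := fun u => -∑ j, L i j * x (t j (K j u)) j)
    (B := fun u => x (t i k) i + C * (u - t i k)) (B' := fun _ => C)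
    ((continuous_apply i).comp S.cont).continuousOn
    (fun u hu => S.hasDerivWithinAt i (hk.trans hu.1)) (by simp) (by fun_prop)
    (fun u _ => by
      simpa using ((((hasDerivAt_id u).sub_const (t i k)).const_mul C).const_add
        (x (t i k) i)).hasDerivWithinAt)
    (fun u hu => by
      have hKi : K i u = k := S.last_eq (hk.trans hu.1) hu.1 (hu.2.trans_le hsk)
      have := S.sum_le (i := i) (hM u hu) (hw u hu) hwi
      rwa [hKi] at this)
    (Set.right_mem_Icc.2 hks)
  rw [hC] at key
  linarith

theorem delta_mul_le_gap (S : SelfTriggered L δ t K T₀ h x) {i : Fin n} {k : ℕ} {s M : ℝ}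
    (hk : T₀ ≤ t i k) (hks : t i k ≤ s) (hsk : s ≤ t i (k + 1))
    (hM : ∀ u ∈ Set.Ico (t i k) s, ∀ j, x (t j (K j u)) j ≤ M) (hi : x (t i k) i ≤ M) :
    δ i * (M - x (t i k) i) ≤ M - x s i := by
  have key := S.le_gap (w := i) (η := 0) hk hks hsk hM
    (fun u hu => by simpa using hM u hu i) (Or.inr rfl)
  have h1 : L i i * (s - t i k) ≤ L i i * (t i (k + 1) - t i k) :=
    mul_le_mul_of_nonneg_left (by linarith) (S.diag_pos i).le
  have h2 := S.le_one_sub_delta i k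
  have h3 : δ i * (M - x (t i k) i) ≤ (1 - L i i * (s - t i k)) * (M - x (t i k) i) :=
    mul_le_mul_of_nonneg_right (by linarith) (by linarith)
  linarith

/-- An upper bound of the held values on a window of length `h` is an upper bound ever after. -/
theorem held_le_of_window (S : SelfTriggered L δ t K T₀ h x) (hh : 0 ≤ h) {T M : ℝ} (hT : T₀ ≤ T)
    (hM : ∀ u ∈ Set.Icc T (T + h), ∀ j, x (t j (K j u)) j ≤ M) :
    ∀ u, T ≤ u → ∀ j, x (t j (K j u)) j ≤ M := by
  suffices H : ∀ N : ℕ, ∀ s, T ≤ s → ∑ j, K j s ≤ N → ∀ j, x (t j (K j s)) j ≤ M from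
    fun u hu => H _ u hu le_rfl
  intro N
  induction N using Nat.strong_induction_on with
  | _ N ih =>
  intro s hs hN j
  rcases le_or_gt s (T + h) with hsT | hsT
  · exact hM s ⟨hs, hsT⟩ j
  have hs0 : T₀ ≤ s := hT.trans hs
  have h1 := S.sub_lt_last j hs0
  obtain ⟨k, hk⟩ := S.exists_last_eq_succ j (s := s) hh (by linarith)
  have h2 := S.last_le j s hs0
  rw [hk] at h1 h2 ⊢
  have hlt := S.strictMono j (Nat.lt_succ_self (k + 1))
  rcases le_or_gt (t j (k + 1)) (T + h) with hkT | hkT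
  · have := hM (t j (k + 1)) ⟨by linarith, hkT⟩ j
    rwa [S.last_eq (k := k + 1) (by linarith) le_rfl hlt] at this
  have h3 := S.gap_le j k
  have hkk := S.strictMono j (Nat.lt_succ_self k)
  have hbd : ∀ u ∈ Set.Ico (t j k) (t j (k + 1)), ∀ i, x (t i (K i u)) i ≤ M := by
    intro u hu
    refine ih (∑ i, K i u) (lt_of_lt_of_le ?_ hN) u (by linarith [hu.1]) le_rfl
    refine Finset.sum_lt_sum
      (fun i _ => S.last_mono i (by linarith [hu.1]) (by linarith [hu.2])) ⟨j, Finset.mem_univ j, ?_⟩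
    rw [hk, S.last_eq (by linarith [hu.1]) hu.1 hu.2]
    omega
  have hxk : x (t j k) j ≤ M := by
    have := hbd (t j k) ⟨le_rfl, hkk⟩ j
    rwa [S.last_eq (by linarith) le_rfl hkk] at this
  have := S.delta_mul_le_gap (k := k) (s := t j (k + 1)) (by linarith) hkk.le le_rfl hbd hxk
  have := mul_nonneg (S.delta_pos j).le (sub_nonneg.2 hxk)
  linarith

/-- Over a bounded horizon, an agent keeps a fixed fraction of its distance to an upper bound. -/
theorem exists_persistence (S : SelfTriggered L δ t K T₀ h x) (hh : 0 ≤ h) (i : Fin n) (H : ℝ) :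
    ∃ c > 0, ∀ T M g s₀, T₀ ≤ T → (∀ u, T ≤ u → ∀ j, x (t j (K j u)) j ≤ M) → T + h ≤ s₀ →
      0 ≤ g → g ≤ M - x (t i (K i s₀)) i →
      ∀ s ∈ Set.Icc s₀ (s₀ + H), c * g ≤ M - x (t i (K i s)) i := by
  have hδ := S.delta_pos i
  have hδ1 : δ i ≤ 1 := by
    have := S.le_one_sub_delta i 0
    have := S.delta_le i 0
    linarith
  obtain ⟨Q, hQ⟩ := exists_nat_ge (L i i * (H + h) / δ i)
  refine ⟨δ i ^ Q, pow_pos hδ Q, fun T M g s₀ hT hM hs₀ hg hgap s hs => ?_⟩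
  have hs₀T : T₀ ≤ s₀ := by linarith
  have hlast := S.sub_lt_last i hs₀T
  set k := K i s₀
  have hTk : ∀ q, T ≤ t i (k + q) := fun q => by
    have := (S.strictMono i).monotone (Nat.le_add_right k q)
    linarith
  have hheld : ∀ q, x (t i (k + q)) i ≤ M := fun q => by
    have := hM _ (hTk q) i
    rwa [S.last_eq (k := k + q) (hT.trans (hTk q)) le_rfl
      (S.strictMono i (Nat.lt_succ_self _))] at this
  have hpow : ∀ q, δ i ^ q * g ≤ M - x (t i (k + q)) i := by
    intro q
    induction q with
    | zero => simpa using hgap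
    | succ q ih =>
      have h1 := S.delta_mul_le_gap (k := k + q) (s := t i (k + q + 1)) (hT.trans (hTk q))
        (S.strictMono i (Nat.lt_succ_self _)).le le_rfl
        (fun u hu => hM u ((hTk q).trans hu.1)) (hheld q)
      have h2 := mul_le_mul_of_nonneg_left ih hδ.le
      rw [pow_succ']
      rw [← add_assoc]
      linarith
  have hdist : ∀ q : ℕ, δ i * q ≤ L i i * (t i (k + q) - t i k) := by
    intro q
    induction q with
    | zero => simp
    | succ q ih =>
      have := S.delta_le i (k + q)
      push_cast
      rw [← add_assoc]
      linarith
  obtain ⟨q, hq⟩ := Nat.exists_eq_add_of_le (S.last_mono i hs₀T hs.1)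
  have hqs : t i (k + q) ≤ s := by
    have := S.last_le i s (hs₀T.trans hs.1)
    rwa [hq] at this
  have hqQ : q ≤ Q := by
    have h1 := hdist q
    have h2 : L i i * (t i (k + q) - t i k) ≤ L i i * (H + h) :=
      mul_le_mul_of_nonneg_left (by linarith [hs.2]) (S.diag_pos i).le
    have h3 : (q : ℝ) ≤ L i i * (H + h) / δ i := by
      rw [le_div_iff₀ hδ]
      linarith
    exact_mod_cast h3.trans hQ
  rw [hq]
  refine le_trans ?_ (hpow q)
  exact mul_le_mul_of_nonneg_right (pow_le_pow_of_le_one hδ.le hδ1 hqQ) hg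

/-- A gap of the root below an upper bound propagates along directed paths. -/
theorem exists_propagation (S : SelfTriggered L δ t K T₀ h x) (hh : 0 ≤ h) {r v : Fin n}
    (hrv : Relation.ReflTransGen (fun j i : Fin n => i ≠ j ∧ L i j < 0) r v) :
    ∃ D ≥ 0, ∀ H, ∃ c > 0, ∀ T M g, T₀ ≤ T → (∀ u, T ≤ u → ∀ j, x (t j (K j u)) j ≤ M) →
      0 ≤ g → g ≤ M - x (t r (K r (T + h))) r →
      ∀ s ∈ Set.Icc (T + h + D) (T + h + D + H), c * g ≤ M - x (t v (K v s)) v := by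
  induction hrv with
  | refl =>
    refine ⟨0, le_rfl, fun H => ?_⟩
    obtain ⟨c, hc, hP⟩ := S.exists_persistence hh r H
    refine ⟨c, hc, fun T M g hT hM hg hgap s hs => ?_⟩
    rw [add_zero] at hs
    exact hP T M g _ hT hM le_rfl hg hgap s hs
  | @tail w v _ hwv ih =>
    obtain ⟨D, hD, ih⟩ := ih
    refine ⟨D + 2 * h, by linarith, fun H => ?_⟩
    obtain ⟨c₁, hc₁, ih⟩ := ih (2 * h)
    obtain ⟨c₂, hc₂, hP⟩ := S.exists_persistence hh v H
    have hL : 0 < -L v w := neg_pos.2 hwv.2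
    have ha : 0 < -L v w * (δ v / L v v) := mul_pos hL (div_pos (S.delta_pos v) (S.diag_pos v))
    refine ⟨c₂ * (-L v w * (δ v / L v v) * c₁), by positivity,
      fun T M g hT hM hg hgap s hs => ?_⟩
    have hw := ih T M g hT hM hg hgap
    rw [mul_assoc]
    refine hP T M _ (T + h + (D + 2 * h)) hT hM (by linarith) (by positivity) ?_ s hs
    set τ := T + h + (D + 2 * h) with hτ
    have hτ0 : T₀ ≤ τ := by linarith
    obtain ⟨k, hk⟩ := S.exists_last_eq_succ v (s := τ) hh (by linarith)
    have h1 := S.sub_lt_last v hτ0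
    have h2 := S.last_le v τ hτ0
    rw [hk] at h1 h2 ⊢
    have h3 := S.gap_le v k
    have hkk := S.strictMono v (Nat.lt_succ_self k)
    have hxk : x (t v k) v ≤ M := by
      have := hM (t v k) (by linarith) v
      rwa [S.last_eq (by linarith) le_rfl hkk] at this
    have key := S.le_gap (i := v) (w := w) (k := k) (s := t v (k + 1)) (M := M) (η := c₁ * g)
      (by linarith) hkk.le le_rfl (fun u hu => hM u (by linarith [hu.1]))
      (fun u hu => by linarith [hw u ⟨by linarith [hu.1], by linarith [hu.2]⟩])
      (Or.inl hwv.1.symm)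
    have h4 : 0 ≤ (1 - L v v * (t v (k + 1) - t v k)) * (M - x (t v k) v) :=
      mul_nonneg (by linarith [S.le_one_sub_delta v k, S.delta_pos v]) (by linarith)
    have h5 : δ v / L v v ≤ t v (k + 1) - t v k := by
      rw [div_le_iff₀ (S.diag_pos v)]
      linarith [S.delta_le v k]
    have h6 : -L v w * (c₁ * g) * (δ v / L v v) ≤ -L v w * (c₁ * g) * (t v (k + 1) - t v k) :=
      mul_le_mul_of_nonneg_left h5 (by positivity)
    linarith

/-- If the root is `g` below an upper bound of all held values, then after a fixed time all held
values are at least a fixed fraction of `g` below that bound. -/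
theorem exists_decrease (S : SelfTriggered L δ t K T₀ h x) (hh : 0 ≤ h) {r : Fin n}
    (hr : ∀ v, Relation.ReflTransGen (fun j i : Fin n => i ≠ j ∧ L i j < 0) r v) :
    ∃ D ≥ 0, ∃ c > 0, ∀ T M g, T₀ ≤ T → (∀ u, T ≤ u → ∀ j, x (t j (K j u)) j ≤ M) →
      0 ≤ g → g ≤ M - x (t r (K r (T + h))) r →
      ∀ u, T + D ≤ u → ∀ j, x (t j (K j u)) j ≤ M - c * g := by
  choose D hD hP using fun v => S.exists_propagation hh (hr v)
  obtain ⟨D', hD'⟩ := Finite.exists_le D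
  choose c hc hP using fun v => hP v (D' - D v + h)
  have : Nonempty (Fin n) := ⟨r⟩
  obtain ⟨v₀, hv₀⟩ := Finite.exists_min c
  have hD'0 : 0 ≤ D' := (hD r).trans (hD' r)
  refine ⟨h + D', by positivity, c v₀, hc v₀, fun T M g hT hM hg hgap => ?_⟩
  refine S.held_le_of_window hh (by linarith) fun u hu j => ?_
  have := hP j T M g hT hM hg hgap u ⟨by linarith [hu.1, hD' j], by linarith [hu.2]⟩
  have := mul_le_mul_of_nonneg_right (hv₀ j) hg
  linarith

theorem exists_contraction (S : SelfTriggered L δ t K T₀ h x) (hh : 0 ≤ h) {r : Fin n}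
    (hr : ∀ v, Relation.ReflTransGen (fun j i : Fin n => i ≠ j ∧ L i j < 0) r v) :
    ∃ ρ, 0 ≤ ρ ∧ ρ < 1 ∧ ∀ T m M, T₀ ≤ T →
      (∀ u, T ≤ u → ∀ j, x (t j (K j u)) j ∈ Set.Icc m M) →
      ∃ T' m' M', T₀ ≤ T' ∧ (∀ u, T' ≤ u → ∀ j, x (t j (K j u)) j ∈ Set.Icc m' M') ∧
        M' - m' ≤ ρ * (M - m) := by
  obtain ⟨D₁, hD₁, c₁, hc₁, hP₁⟩ := S.exists_decrease hh hr
  obtain ⟨D₂, hD₂, c₂, hc₂, hP₂⟩ := S.neg.exists_decrease hh hr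
  refine ⟨max 0 (1 - min c₁ c₂ / 2), le_max_left _ _, max_lt one_pos ?_,
    fun T m M hT hb => ?_⟩
  · have := lt_min hc₁ hc₂
    linarith
  have hmM : 0 ≤ M - m := by
    have := hb T le_rfl r
    linarith [this.1, this.2]
  have hρ : (1 - min c₁ c₂ / 2) * (M - m) ≤ max 0 (1 - min c₁ c₂ / 2) * (M - m) :=
    mul_le_mul_of_nonneg_right (le_max_right _ _) hmM
  have hm₁ := mul_le_mul_of_nonneg_right (min_le_left c₁ c₂) hmM
  have hm₂ := mul_le_mul_of_nonneg_right (min_le_right c₁ c₂) hmM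
  rcases le_total (x (t r (K r (T + h))) r) ((M + m) / 2) with hx | hx
  · have := hP₁ T M ((M - m) / 2) hT (fun u hu j => (hb u hu j).2) (by linarith) (by linarith)
    exact ⟨T + D₁, m, M - c₁ * ((M - m) / 2), by linarith,
      fun u hu j => ⟨(hb u (by linarith) j).1, this u hu j⟩, by linarith⟩
  · have := hP₂ T (-m) ((M - m) / 2) hT (fun u hu j => neg_le_neg (hb u hu j).1) (by linarith)
      (by simp only [Pi.neg_apply]; linarith)
    refine ⟨T + D₂, m + c₂ * ((M - m) / 2), M, by linarith,
      fun u hu j => ⟨?_, (hb u (by linarith) j).2⟩, by linarith⟩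
    have := this u hu j
    simp only [Pi.neg_apply] at this
    linarith

theorem exists_held_le (S : SelfTriggered L δ t K T₀ h x) (hh : 0 ≤ h) :
    ∃ M, ∀ u, T₀ ≤ u → ∀ j, x (t j (K j u)) j ≤ M := by
  have hbd : ∀ j, ∃ B, ∀ s ∈ Set.Icc (T₀ - h) (T₀ + h), x s j ≤ B := fun j => by
    obtain ⟨B, hB⟩ := (isCompact_Icc (a := T₀ - h) (b := T₀ + h)).bddAbove_image
      (f := fun s => x s j) ((continuous_apply j).comp S.cont).continuousOn
    exact ⟨B, fun s hs => hB ⟨s, hs, rfl⟩⟩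
  choose B hB using hbd
  obtain ⟨M, hM⟩ := Finite.exists_le B
  refine ⟨M, S.held_le_of_window hh le_rfl fun u hu j => (hB j _ ⟨?_, ?_⟩).trans (hM j)⟩
  · linarith [S.sub_lt_last j hu.1, hu.1]
  · linarith [S.last_le j u hu.1, hu.2]

theorem le_of_held_le (S : SelfTriggered L δ t K T₀ h x) (hh : 0 ≤ h) {T M : ℝ} (hT : T₀ ≤ T)
    (hM : ∀ u, T ≤ u → ∀ j, x (t j (K j u)) j ≤ M) {s : ℝ} (hs : T + h ≤ s) (i : Fin n) :
    x s i ≤ M := by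
  have hs0 : T₀ ≤ s := by linarith
  have h1 := S.sub_lt_last i hs0
  have hi := hM s (by linarith) i
  have := S.delta_mul_le_gap (by linarith) (S.last_le i s hs0) (S.lt_next i hs0).le
    (fun u hu => hM u (by linarith [hu.1])) hi
  have := mul_nonneg (S.delta_pos i).le (sub_nonneg.2 hi)
  linarith

theorem exists_Icc (S : SelfTriggered L δ t K T₀ h x) (hh : 0 ≤ h) {r : Fin n}
    (hr : ∀ v, Relation.ReflTransGen (fun j i : Fin n => i ≠ j ∧ L i j < 0) r v)
    {ε : ℝ} (hε : 0 < ε) : ∃ T m M, M - m < ε ∧ ∀ s, T ≤ s → ∀ i, x s i ∈ Set.Icc m M := by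
  obtain ⟨ρ, hρ0, hρ1, hc⟩ := S.exists_contraction hh hr
  obtain ⟨M₀, hM₀⟩ := S.exists_held_le hh
  obtain ⟨m₀, hm₀⟩ := S.neg.exists_held_le hh
  have hiter : ∀ N : ℕ, ∃ T m M, T₀ ≤ T ∧
      (∀ u, T ≤ u → ∀ j, x (t j (K j u)) j ∈ Set.Icc m M) ∧ M - m ≤ ρ ^ N * (M₀ + m₀) := by
    intro N
    induction N with
    | zero => exact ⟨T₀, -m₀, M₀, le_rfl,
        fun u hu j => ⟨neg_le.1 (hm₀ u hu j), hM₀ u hu j⟩, by simp⟩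
    | succ N ih =>
      obtain ⟨T, m, M, hT, hb, hw⟩ := ih
      obtain ⟨T', m', M', hT', hb', hw'⟩ := hc T m M hT hb
      refine ⟨T', m', M', hT', hb', hw'.trans ?_⟩
      rw [pow_succ', mul_assoc]
      exact mul_le_mul_of_nonneg_left hw hρ0
  have hlim : Tendsto (fun N : ℕ => ρ ^ N * (M₀ + m₀)) atTop (𝓝 0) := by
    simpa using (tendsto_pow_atTop_nhds_zero_of_lt_one hρ0 hρ1).mul_const (M₀ + m₀)
  obtain ⟨N, hN⟩ := (hlim.eventually_lt_const hε).exists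
  obtain ⟨T, m, M, hT, hb, hw⟩ := hiter N
  refine ⟨T + h, m, M, hw.trans_lt hN, fun s hs i => ⟨?_, ?_⟩⟩
  · exact neg_le_neg_iff.1
      (S.neg.le_of_held_le hh hT (fun u hu j => neg_le_neg (hb u hu j).1) hs i)
  · exact S.le_of_held_le hh hT (fun u hu j => (hb u hu j).2) hs i

theorem exists_tendsto (S : SelfTriggered L δ t K T₀ h x) (hh : 0 ≤ h) {r : Fin n}
    (hr : ∀ v, Relation.ReflTransGen (fun j i : Fin n => i ≠ j ∧ L i j < 0) r v) :
    ∃ xs : ℝ, ∀ i, Tendsto (fun u => x u i) atTop (𝓝 xs) := by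
  have hcauchy : CauchySeq fun u => x u r := by
    refine Metric.cauchySeq_iff'.2 fun ε hε => ?_
    obtain ⟨T, m, M, hw, hb⟩ := S.exists_Icc hh hr hε
    exact ⟨T, fun s hs => (Real.dist_le_of_mem_Icc (hb s hs r) (hb T le_rfl r)).trans_lt hw⟩
  obtain ⟨xs, hxs⟩ := cauchySeq_tendsto_of_complete hcauchy
  refine ⟨xs, fun i => hxs.congr_dist (Metric.tendsto_atTop.2 fun ε hε => ?_)⟩
  obtain ⟨T, m, M, hw, hb⟩ := S.exists_Icc hh hr hε
  refine ⟨T, fun s hs => ?_⟩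
  rw [Real.dist_0_eq_abs, abs_of_nonneg dist_nonneg]
  exact (Real.dist_le_of_mem_Icc (hb s hs r) (hb s hs i)).trans_lt hw

end SelfTriggered

/-- Theorem 3: distributed self-triggered consensus, fixed topology.
`K j s` plays the role of `k_j(s) = max {k : t_j^k ≤ s}`, characterized for all
`s ≥ max_i t_i^0` by the hypothesis `hK`. -/
theorem distributed_selfTriggered_consensus
    {n : ℕ} (L : Fin n → Fin n → ℝ) (hL : IsLaplacian L)
    (htree : HasSpanningTreeRel (fun j i : Fin n => i ≠ j ∧ L i j < 0))
    (hdiag : ∀ i, 0 < L i i)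
    (δᵢ : Fin n → ℝ) (hδᵢ : ∀ i, δᵢ i ∈ Set.Ioo (0 : ℝ) (1 / 2))
    (t : Fin n → ℕ → ℝ) (hmono : ∀ i, StrictMono (t i))
    (hΔ : ∀ i k, t i (k + 1) - t i k ∈ Set.Icc (δᵢ i / L i i) ((1 - δᵢ i) / L i i))
    (x : ℝ → Fin n → ℝ) (hcont : Continuous x)
    (K : Fin n → ℝ → ℕ)
    (hK : ∀ j s, (∀ i, t i 0 ≤ s) →
      t j (K j s) ≤ s ∧ ∀ k, t j k ≤ s → k ≤ K j s)
    (hdyn : ∀ s, (∀ i, t i 0 ≤ s) → (∀ i k, s ≠ t i k) → ∀ i,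
      HasDerivAt (fun u => x u i) (-∑ j, L i j * x (t j (K j s)) j) s) :
    ∃ xs : ℝ, ∀ i, Tendsto (fun u => x u i) atTop (𝓝 xs) := by
  obtain ⟨r, hr⟩ := htree
  obtain ⟨T₀, hT₀⟩ := Finite.exists_le fun i => t i 0
  obtain ⟨h, hh⟩ := Finite.exists_le fun i => (1 - δᵢ i) / L i i
  have S : SelfTriggered L δᵢ t K T₀ h x :=
    { laplacian := hL
      diag_pos := hdiag
      delta_pos := fun i => (hδᵢ i).1
      strictMono := hmono
      delta_le := fun i k => (div_le_iff₀' (hdiag i)).1 (hΔ i k).1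
      le_one_sub_delta := fun i k => (le_div_iff₀' (hdiag i)).1 (hΔ i k).2
      gap_le := fun i k => (hΔ i k).2.trans (hh i)
      cont := hcont
      start_le := hT₀
      last_le := fun j s hs => (hK j s fun i => (hT₀ i).trans hs).1
      le_last := fun j s k hs => (hK j s fun i => (hT₀ i).trans hs).2 k
      dyn := fun s hs => hdyn s fun i => (hT₀ i).trans hs }
  refine S.exists_tendsto ?_ hr
  have := S.gap_le r 0
  have := hmono r zero_lt_one
  simp only [zero_add] at *
  linarith
end

section
/- Let L ∈ ℝ^{n×n} be a graph Laplacian with l_ii > 0 for every i. For each agent i let δ_i ∈ (0, 1/2) and let t_i^0 < t_i^1 < … be its update times with Δt_i^k := t_i^{k+1} − t_i^k ∈ [δ_i/l_ii, (1−δ_i)/l_ii] for all k, and set k_j(t) = max{k : t_j^k ≤ t}. Let x : ℝ → ℝ^n be continuous and satisfy ẋ_i(t) = −∑_{j=1}^n l_ij x_j(t_j^{k_j(t)}) for every i and every t that is not an update time of any agent. If there exists x* ∈ ℝ such that lim_{k→∞} x_i(t_i^k) = x* for every i = 1, …, n, then lim_{t→∞} x_i(t) = x* for every i = 1, …, n.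 -/
open Filter Topology

/-- Mean value inequality for a function differentiable off a finite set. -/
theorem abs_sub_le_of_hasDerivAt_off_finset {f f' : ℝ → ℝ} {C : ℝ} (hf : Continuous f)
    (S : Finset ℝ) {a b : ℝ} (hab : a ≤ b)
    (hderiv : ∀ s ∈ Set.Ioo a b, s ∉ S → HasDerivAt f (f' s) s)
    (hbound : ∀ s ∈ Set.Ioo a b, |f' s| ≤ C) :
    |f b - f a| ≤ C * (b - a) := by
  induction S using Finset.induction_on generalizing a b with
  | empty =>
    rcases hab.eq_or_lt with rfl | hlt
    · simp
    obtain ⟨c, hc, hslope⟩ := exists_hasDerivAt_eq_slope f f' hlt hf.continuousOn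
      fun s hs => hderiv s hs (Finset.notMem_empty s)
    have hpos : 0 < b - a := sub_pos.2 hlt
    have hfc := hbound c hc
    rwa [hslope, abs_div, abs_of_pos hpos, div_le_iff₀ hpos] at hfc
  | insert p S _ ih =>
    by_cases hp : p ∈ Set.Ioo a b
    · have hleft := ih hp.1.le
        (fun s hs hsS => hderiv s ⟨hs.1, hs.2.trans hp.2⟩
          (by simp [hsS, hs.2.ne]))
        (fun s hs => hbound s ⟨hs.1, hs.2.trans hp.2⟩)
      have hright := ih hp.2.le
        (fun s hs hsS => hderiv s ⟨hp.1.trans hs.1, hs.2⟩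
          (by simp [hsS, hs.1.ne']))
        (fun s hs => hbound s ⟨hp.1.trans hs.1, hs.2⟩)
      linarith [abs_sub_le (f b) (f p) (f a)]
    · refine ih hab (fun s hs hsS => hderiv s hs ?_) hbound
      rw [Finset.mem_insert, not_or]
      exact ⟨fun h => hp (h ▸ hs), hsS⟩

/-- Lemma 1: if the sampled states `x_i(t_i^k)` all converge to a
common value `x*`, then every `x_i(t)` converges to `x*` as `t → ∞`.
`K j s` plays the role of `k_j(s) = max {k : t_j^k ≤ s}`, characterized for all
`s ≥ max_i t_i^0` by the hypothesis `hK`. -/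
theorem distributed_selfTriggered_sampled_limit_implies_consensus
    {n : ℕ} (L : Fin n → Fin n → ℝ) (hL : IsLaplacian L)
    (hdiag : ∀ i, 0 < L i i)
    (δᵢ : Fin n → ℝ) (hδᵢ : ∀ i, δᵢ i ∈ Set.Ioo (0 : ℝ) (1 / 2))
    (t : Fin n → ℕ → ℝ) (hmono : ∀ i, StrictMono (t i))
    (hΔ : ∀ i k, t i (k + 1) - t i k ∈ Set.Icc (δᵢ i / L i i) ((1 - δᵢ i) / L i i))
    (x : ℝ → Fin n → ℝ) (hcont : Continuous x)
    (K : Fin n → ℝ → ℕ)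
    (hK : ∀ j s, (∀ i, t i 0 ≤ s) →
      t j (K j s) ≤ s ∧ ∀ k, t j k ≤ s → k ≤ K j s)
    (hdyn : ∀ s, (∀ i, t i 0 ≤ s) → (∀ i k, s ≠ t i k) → ∀ i,
      HasDerivAt (fun u => x u i) (-∑ j, L i j * x (t j (K j s)) j) s)
    (xs : ℝ)
    (hlim : ∀ i, Tendsto (fun k => x (t i k) i) atTop (𝓝 xs)) :
    ∀ i, Tendsto (fun u => x u i) atTop (𝓝 xs) := by
  intro i
  have hstart : ∀ᶠ s in atTop, ∀ i, t i 0 ≤ s :=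
    eventually_all.2 fun i => eventually_ge_atTop (t i 0)
  have hKtop (j : Fin n) : Tendsto (K j) atTop atTop := by
    refine tendsto_atTop.2 fun k => ?_
    filter_upwards [hstart, eventually_ge_atTop (t j k)] with s hs hks
    exact (hK j s hs).2 k hks
  have hsample (j : Fin n) : Tendsto (fun s => x (t j (K j s)) j) atTop (𝓝 xs) :=
    (hlim j).comp (hKtop j)
  have hvel : Tendsto (fun s => -∑ j, L i j * x (t j (K j s)) j) atTop (𝓝 0) := by
    have h := (tendsto_finsetSum Finset.univ fun j _ => (hsample j).const_mul (L i j)).neg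
    rwa [← Finset.sum_mul, hL.2 i, zero_mul, neg_zero] at h
  set C := (1 - δᵢ i) / L i i
  have hC : 0 < C := div_pos (by linarith [(hδᵢ i).2]) (hdiag i)
  have hdrift : Tendsto (fun s => x s i - x (t i (K i s)) i) atTop (𝓝 0) := by
    rw [Metric.tendsto_atTop]
    intro ε hε
    have hsmall : ∀ᶠ s in atTop, |-∑ j, L i j * x (t j (K j s)) j| < ε / 2 / C := by
      simpa [Real.dist_eq] using
        (Metric.tendsto_nhds.1 hvel (ε / 2 / C) (by positivity))
    obtain ⟨T, hT⟩ := eventually_atTop.1 (hstart.and hsmall)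
    refine ⟨T + C, fun s hs => ?_⟩
    have hs0 := (hT s (by linarith)).1
    obtain ⟨hle, hmax⟩ := hK i s hs0
    have hlt : s < t i (K i s + 1) := by
      by_contra! h
      exact absurd (hmax _ h) (by lia)
    have hgap : s - t i (K i s) ≤ C := by linarith [(hΔ i (K i s)).2]
    have hmvt := abs_sub_le_of_hasDerivAt_off_finset (f := fun u => x u i)
      (f' := fun u => -∑ j, L i j * x (t j (K j u)) j) (C := ε / 2 / C) (by fun_prop)
      (Finset.univ.biUnion fun j => (Finset.range (K j s + 1)).image (t j)) hle
      (fun u hu huS => by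
        refine hdyn u (hT u (by linarith [hu.1])).1 (fun j k huk => huS ?_) i
        simp only [Finset.mem_biUnion, Finset.mem_univ, true_and, Finset.mem_image,
          Finset.mem_range]
        exact ⟨j, k, Nat.lt_succ_of_le ((hK j s hs0).2 k (huk ▸ hu.2.le)), huk.symm⟩)
      (fun u hu => (hT u (by linarith [hu.1])).2.le)
    rw [Real.dist_eq, sub_zero]
    calc |x s i - x (t i (K i s)) i| ≤ ε / 2 / C * (s - t i (K i s)) := hmvt
      _ ≤ ε / 2 / C * C := by gcongr
      _ = ε / 2 := div_mul_cancel₀ _ hC.ne'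
      _ < ε := half_lt_self hε
  simpa using hdrift.add (hsample i)
end

section
/- Let L ∈ ℝ^{n×n} be a graph Laplacian whose directed graph G(L) has a spanning tree and with l_ii > 0 for every i. For each agent i let δ_i ∈ (0, 1/2) and let t_i^0 < t_i^1 < … be its update times with Δt_i^k := t_i^{k+1} − t_i^k ∈ [δ_i/l_ii, (1−δ_i)/l_ii] for all k, and set k_j(t) = max{k : t_j^k ≤ t}. Let x : ℝ → ℝ^n be continuous and satisfy ẋ_i(t) = −∑_{j=1}^n l_ij x_j(t_j^{k_j(t)}) for every i and every t that is not an update time of any agent. Then there exists x* ∈ ℝ such that lim_{k→∞} x_i(t_i^k) = x* for every i = 1, …, n. -/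
open Filter Topology

section

open Set

/-- A mean value inequality for continuous functions that are differentiable off a finite set. -/
theorem sub_le_mul_sub_of_hasDerivAt_le_off_finset {f f' : ℝ → ℝ} {C : ℝ} (hf : Continuous f)
    (S : Finset ℝ) : ∀ {a b : ℝ}, a ≤ b →
      (∀ s ∈ Ioo a b, s ∉ S → HasDerivAt f (f' s) s) → (∀ s ∈ Ioo a b, f' s ≤ C) →
      f b - f a ≤ C * (b - a) := by
  induction S using Finset.induction_on with
  | empty =>
    intro a b hab hd hC
    refine (convex_Icc a b).image_sub_le_mul_sub_of_deriv_le hf.continuousOn ?_ ?_ a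
      (left_mem_Icc.2 hab) b (right_mem_Icc.2 hab) hab
    · rw [interior_Icc]
      intro s hs
      exact (hd s hs (by simp)).differentiableAt.differentiableWithinAt
    · rw [interior_Icc]
      intro s hs
      rw [(hd s hs (by simp)).deriv]
      exact hC s hs
  | insert p S _ ih =>
    intro a b hab hd hC
    by_cases hp : p ∈ Ioo a b
    · have h₁ := ih hp.1.le
        (fun s hs hsS => hd s ⟨hs.1, hs.2.trans hp.2⟩ (by simp [hs.2.ne, hsS]))
        (fun s hs => hC s ⟨hs.1, hs.2.trans hp.2⟩)
      have h₂ := ih hp.2.le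
        (fun s hs hsS => hd s ⟨hp.1.trans hs.1, hs.2⟩ (by simp [hs.1.ne', hsS]))
        (fun s hs => hC s ⟨hp.1.trans hs.1, hs.2⟩)
      linarith
    · refine ih hab (fun s hs hsS => hd s hs ?_) hC
      have : s ≠ p := fun h => hp (h ▸ hs)
      simp [this, hsS]

/-- The trajectory `x` of the self-triggered consensus dynamics, where all agents have started by
time `T` and consecutive updates are at most `D` apart. -/
structure IsSelfTriggered {n : ℕ} (L : Fin n → Fin n → ℝ) (δ : Fin n → ℝ) (t : Fin n → ℕ → ℝ)
    (K : Fin n → ℝ → ℕ) (T D : ℝ) (x : ℝ → Fin n → ℝ) : Prop where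
  laplacian : IsLaplacian L
  diag_pos : ∀ i, 0 < L i i
  margin_pos : ∀ i, 0 < δ i
  strictMono : ∀ i, StrictMono (t i)
  step_mem : ∀ i k, t i (k + 1) - t i k ∈ Icc (δ i / L i i) ((1 - δ i) / L i i)
  step_le : ∀ i k, t i (k + 1) - t i k ≤ D
  start_le : ∀ i, t i 0 ≤ T
  continuous : Continuous x
  last : ∀ j s, T ≤ s → t j (K j s) ≤ s ∧ ∀ k, t j k ≤ s → k ≤ K j s
  hasDerivAt : ∀ s, T ≤ s → (∀ i k, s ≠ t i k) → ∀ i,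
    HasDerivAt (fun u => x u i) (-∑ j, L i j * x (t j (K j s)) j) s

namespace IsSelfTriggered

variable {n : ℕ} {L : Fin n → Fin n → ℝ} {δ : Fin n → ℝ} {t : Fin n → ℕ → ℝ}
  {K : Fin n → ℝ → ℕ} {T D : ℝ} {x : ℝ → Fin n → ℝ}

theorem neg (h : IsSelfTriggered L δ t K T D x) :
    IsSelfTriggered L δ t K T D (fun s i => -x s i) where
  __ := h
  continuous := h.continuous.neg
  hasDerivAt s hs hne i := by
    have := (h.hasDerivAt s hs hne i).fun_neg
    simpa only [mul_neg, Finset.sum_neg_distrib] using this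

theorem lt_succ_last (h : IsSelfTriggered L δ t K T D x) (j : Fin n) {s : ℝ} (hs : T ≤ s) :
    s < t j (K j s + 1) := by
  by_contra! hle
  have := (h.last j s hs).2 _ hle
  omega

theorem last_eq (h : IsSelfTriggered L δ t K T D x) {j : Fin n} {k : ℕ} {s : ℝ} (hs : T ≤ s)
    (h₁ : t j k ≤ s) (h₂ : s < t j (k + 1)) : K j s = k := by
  refine le_antisymm ?_ ((h.last j s hs).2 k h₁)
  have := (h.strictMono j).lt_iff_lt.1 ((h.last j s hs).1.trans_lt h₂)
  omega

theorem last_update (h : IsSelfTriggered L δ t K T D x) {j : Fin n} {k : ℕ} (hk : T ≤ t j k) :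
    K j (t j k) = k :=
  h.last_eq hk le_rfl (h.strictMono j k.lt_succ_self)

theorem last_mono (h : IsSelfTriggered L δ t K T D x) (j : Fin n) {s u : ℝ} (hs : T ≤ s)
    (hsu : s ≤ u) : K j s ≤ K j u :=
  (h.last j u (hs.trans hsu)).2 _ ((h.last j s hs).1.trans hsu)

theorem sub_le_last (h : IsSelfTriggered L δ t K T D x) (j : Fin n) {s : ℝ} (hs : T ≤ s) :
    s - D ≤ t j (K j s) := by
  linarith [h.lt_succ_last j hs, h.step_le j (K j s)]

theorem step_pos (h : IsSelfTriggered L δ t K T D x) (r : Fin n) : 0 < D := by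
  linarith [h.step_le r 0, h.strictMono r Nat.zero_lt_one]

theorem mul_le_sub (h : IsSelfTriggered L δ t K T D x) (i : Fin n) (k m : ℕ) :
    m * (δ i / L i i) ≤ t i (k + m) - t i k := by
  induction m with
  | zero => simp
  | succ m ih =>
    have := (h.step_mem i (k + m)).1
    push_cast
    rw [← add_assoc]
    linarith

theorem tendsto_update (h : IsSelfTriggered L δ t K T D x) (i : Fin n) :
    Tendsto (t i) atTop atTop := by
  have hpos : 0 < δ i / L i i := div_pos (h.margin_pos i) (h.diag_pos i)
  refine tendsto_atTop_mono (fun k => ?_)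
    (tendsto_atTop_add_const_right _ (t i 0) (tendsto_natCast_atTop_atTop.atTop_mul_const hpos))
  have := h.mul_le_sub i 0 k
  rw [zero_add] at this
  linarith

/-- One update of agent `i`, measured by the gaps to an upper bound `A`. -/
theorem update_le (h : IsSelfTriggered L δ t K T D x) {i : Fin n} {k : ℕ} (hk : T ≤ t i k)
    {A : ℝ} {g : Fin n → ℝ}
    (hg : ∀ s ∈ Ico (t i k) (t i (k + 1)), ∀ j, j ≠ i → x (t j (K j s)) j ≤ A - g j) :
    x (t i (k + 1)) i ≤ A - (1 - (t i (k + 1) - t i k) * L i i) * (A - x (t i k) i)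
      + (t i (k + 1) - t i k) * ∑ j ∈ Finset.univ.erase i, L i j * g j := by
  classical
  have hlt := h.strictMono i k.lt_succ_self
  set S : Finset ℝ := Finset.univ.biUnion fun j =>
    (Finset.range (K j (t i (k + 1)) + 1)).image (t j) with hS
  have hsum : ∑ j ∈ Finset.univ.erase i, L i j = -L i i := by
    have := h.laplacian.2 i
    rw [← Finset.add_sum_erase _ _ (Finset.mem_univ i)] at this
    linarith
  have key := sub_le_mul_sub_of_hasDerivAt_le_off_finset (f := fun u => x u i)
    (f' := fun s => -∑ j, L i j * x (t j (K j s)) j)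
    (C := L i i * (A - x (t i k) i) + ∑ j ∈ Finset.univ.erase i, L i j * g j)
    ((continuous_apply i).comp h.continuous) S hlt.le ?_ ?_
  · linarith
  · intro s hs hsS
    refine h.hasDerivAt s (hk.trans hs.1.le) (fun j m hjm => hsS ?_) i
    simp only [hS, Finset.mem_biUnion, Finset.mem_univ, true_and, Finset.mem_image,
      Finset.mem_range]
    refine ⟨j, m, Nat.lt_succ_of_le ?_, hjm.symm⟩
    exact (h.last j _ (hk.trans hlt.le)).2 m (hjm ▸ hs.2.le)
  · intro s hs
    have hKi : K i s = k := h.last_eq (hk.trans hs.1.le) hs.1.le hs.2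
    have hle : ∑ j ∈ Finset.univ.erase i, L i j * (A - g j) ≤
        ∑ j ∈ Finset.univ.erase i, L i j * x (t j (K j s)) j :=
      Finset.sum_le_sum fun j hj =>
        mul_le_mul_of_nonpos_left (hg s ⟨hs.1.le, hs.2⟩ j (Finset.ne_of_mem_erase hj))
          (h.laplacian.1 i j (Finset.ne_of_mem_erase hj).symm)
    simp only [mul_sub, Finset.sum_sub_distrib, ← Finset.sum_mul, hsum] at hle
    rw [← Finset.add_sum_erase _ _ (Finset.mem_univ i), hKi]
    linarith

theorem margin_le (h : IsSelfTriggered L δ t K T D x) (i : Fin n) (k : ℕ) :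
    δ i ≤ 1 - (t i (k + 1) - t i k) * L i i := by
  have := (le_div_iff₀ (h.diag_pos i)).1 (h.step_mem i k).2
  linarith

theorem update_le_of_le (h : IsSelfTriggered L δ t K T D x) {i : Fin n} {k : ℕ} (hk : T ≤ t i k)
    {A : ℝ} (hA : ∀ s ∈ Ico (t i k) (t i (k + 1)), ∀ j, x (t j (K j s)) j ≤ A) :
    x (t i (k + 1)) i ≤ A - δ i * (A - x (t i k) i) := by
  have key := h.update_le hk (A := A) (g := 0) fun s hs j _ => by simpa using hA s hs j
  have hi := hA (t i k) ⟨le_rfl, h.strictMono i k.lt_succ_self⟩ i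
  rw [h.last_update hk] at hi
  have := mul_le_mul_of_nonneg_right (h.margin_le i k) (sub_nonneg.2 hi)
  simp only [Pi.zero_apply, mul_zero, Finset.sum_const_zero, add_zero] at key
  linarith

theorem update_le_of_neighbor_le (h : IsSelfTriggered L δ t K T D x) {i j : Fin n} (hij : i ≠ j)
    {k : ℕ} (hk : T ≤ t i k) {A c : ℝ} (hc : 0 ≤ c)
    (hA : ∀ s ∈ Ico (t i k) (t i (k + 1)), ∀ l, x (t l (K l s)) l ≤ A)
    (hj : ∀ s ∈ Ico (t i k) (t i (k + 1)), x (t j (K j s)) j ≤ A - c) :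
    x (t i (k + 1)) i ≤ A - δ i / L i i * -L i j * c := by
  have key := h.update_le hk (A := A) (g := Pi.single j c) fun s hs l _ => by
    by_cases hl : l = j
    · subst hl
      simpa using hj s hs
    · simpa [hl] using hA s hs l
  have hi := hA (t i k) ⟨le_rfl, h.strictMono i k.lt_succ_self⟩ i
  rw [h.last_update hk] at hi
  have h₁ : 0 ≤ (1 - (t i (k + 1) - t i k) * L i i) * (A - x (t i k) i) :=
    mul_nonneg ((h.margin_pos i).le.trans (h.margin_le i k)) (sub_nonneg.2 hi)
  have hsum : ∑ l ∈ Finset.univ.erase i, L i l * (Pi.single j c : Fin n → ℝ) l = L i j * c := by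
    rw [Finset.sum_eq_single_of_mem j (by simp [hij.symm])]
    · simp
    · intro l _ hl
      simp [hl]
  rw [hsum] at key
  have h₂ := mul_le_mul_of_nonneg_right (h.step_mem i k).1
    (mul_nonneg (neg_nonneg.2 (h.laplacian.1 i j hij)) hc)
  linarith

/-- An upper bound on the sampled states over a window of length `D` persists forever. -/
theorem sampled_le_of_window (h : IsSelfTriggered L δ t K T D x) {s A : ℝ} (hs : T ≤ s)
    (hA : ∀ u ∈ Icc s (s + D), ∀ j, x (t j (K j u)) j ≤ A) :
    ∀ u, s ≤ u → ∀ j, x (t j (K j u)) j ≤ A := by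
  suffices ∀ N : ℕ, ∀ u, s ≤ u → ∑ j, K j u ≤ N → ∀ j, x (t j (K j u)) j ≤ A from
    fun u hu => this _ u hu le_rfl
  intro N
  induction N using Nat.strong_induction_on with
  | _ N ih =>
    intro u hu hN i
    have hD := h.step_pos i
    by_cases hw : t i (K i u) ≤ s + D
    · by_cases hle : t i (K i u) ≤ s
      · have : K i s = K i u := h.last_eq hs hle (hu.trans_lt (h.lt_succ_last i (hs.trans hu)))
        rw [← this]
        exact hA s ⟨le_rfl, by linarith⟩ i
      · push Not at hle
        have := hA _ ⟨hle.le, hw⟩ i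
        rwa [h.last_update (hs.trans hle.le)] at this
    · push Not at hw
      have hpos : K i u ≠ 0 := by
        intro h0
        rw [h0] at hw
        linarith [h.start_le i]
      obtain ⟨k, hk⟩ := Nat.exists_eq_succ_of_ne_zero hpos
      have hstep := h.step_le i k
      rw [Nat.succ_eq_add_one] at hk
      rw [hk] at hw ⊢
      have hsk : s ≤ t i k := by linarith
      have huk : t i (k + 1) ≤ u := hk ▸ (h.last i u (hs.trans hu)).1
      have hA' : ∀ v ∈ Ico (t i k) (t i (k + 1)), ∀ j, x (t j (K j v)) j ≤ A := by
        intro v hv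
        have hTv : T ≤ v := (hs.trans hsk).trans hv.1
        refine ih _ (lt_of_lt_of_le ?_ hN) v (hsk.trans hv.1) le_rfl
        refine Finset.sum_lt_sum (fun j _ => h.last_mono j hTv (hv.2.le.trans huk))
          ⟨i, Finset.mem_univ i, ?_⟩
        rw [h.last_eq hTv hv.1 hv.2, hk]
        exact k.lt_succ_self
      have hi := hA' (t i k) ⟨le_rfl, h.strictMono i k.lt_succ_self⟩ i
      rw [h.last_update (hs.trans hsk)] at hi
      have := mul_nonneg (h.margin_pos i).le (sub_nonneg.2 hi)
      linarith [h.update_le_of_le (hs.trans hsk) hA']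

/-- The gap of an agent to a persistent upper bound shrinks at most geometrically. -/
theorem sampled_le_of_gap (h : IsSelfTriggered L δ t K T D x) {s A g : ℝ} (hs : T ≤ s)
    (hA : ∀ u, s ≤ u → ∀ j, x (t j (K j u)) j ≤ A) {r : Fin n} {k : ℕ} (hk : s ≤ t r k)
    (hg : x (t r k) r ≤ A - g) (m : ℕ) : x (t r (k + m)) r ≤ A - δ r ^ m * g := by
  induction m with
  | zero => simpa using hg
  | succ m ih =>
    have hkm : s ≤ t r (k + m) := hk.trans ((h.strictMono r).monotone (Nat.le_add_right k m))
    have := h.update_le_of_le (hs.trans hkm) fun v hv => hA v (hkm.trans hv.1)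
    rw [← add_assoc, pow_succ]
    nlinarith [h.margin_pos r]

/-- A gap at the root spreads to every agent reachable from it. -/
theorem exists_gap_of_reachable (h : IsSelfTriggered L δ t K T D x) (hδ : ∀ i, δ i ≤ 1)
    {r i : Fin n} (hri : Relation.ReflTransGen (fun j i : Fin n => i ≠ j ∧ L i j < 0) r i) :
    ∃ τ, ∀ W, ∃ c > 0, ∀ (s A g : ℝ), T ≤ s → 0 ≤ g →
      (∀ u, s ≤ u → ∀ j, x (t j (K j u)) j ≤ A) → x (t r (K r (s + D))) r ≤ A - g →
      ∀ u ∈ Icc (s + τ) (s + W), x (t i (K i u)) i ≤ A - c * g := by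
  have hD := h.step_pos r
  induction hri with
  | refl =>
    refine ⟨D, fun W => ?_⟩
    have hpos : 0 < δ r / L r r := div_pos (h.margin_pos r) (h.diag_pos r)
    obtain ⟨N, hN⟩ := exists_nat_ge (W / (δ r / L r r))
    rw [div_le_iff₀ hpos] at hN
    refine ⟨δ r ^ N, pow_pos (h.margin_pos r) N, fun s A g hs hg hA hr u hu => ?_⟩
    have hTD : T ≤ s + D := by linarith
    have hk : s ≤ t r (K r (s + D)) := by linarith [h.sub_le_last r hTD]
    obtain ⟨m, hm⟩ := Nat.exists_eq_add_of_le (h.last_mono r hTD hu.1)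
    have key := h.sampled_le_of_gap hs hA hk hr m
    rw [← hm] at key
    have hmN : m ≤ N := by
      have h₁ := h.mul_le_sub r (K r (s + D)) m
      rw [← hm] at h₁
      have h₂ := (h.last r u (hTD.trans hu.1)).1
      have h₃ : (m : ℝ) * (δ r / L r r) ≤ N * (δ r / L r r) := by linarith [hu.2]
      exact_mod_cast le_of_mul_le_mul_right h₃ hpos
    have := mul_le_mul_of_nonneg_right
      (pow_le_pow_of_le_one (h.margin_pos r).le (hδ r) hmN) hg
    linarith
  | @tail j i _ hji ih =>
    obtain ⟨τ, hτ⟩ := ih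
    refine ⟨max τ 0 + 2 * D, fun W => ?_⟩
    obtain ⟨c, hc, hcW⟩ := hτ W
    have hpos : 0 < δ i / L i i := div_pos (h.margin_pos i) (h.diag_pos i)
    refine ⟨δ i / L i i * -L i j * c, mul_pos (mul_pos hpos (neg_pos.2 hji.2)) hc,
      fun s A g hs hg hA hr u hu => ?_⟩
    have hτ₁ := le_max_left τ 0
    have hτ₂ := le_max_right τ 0
    have hTu : T ≤ u := by linarith [hu.1]
    have hlast := h.sub_le_last i hTu
    have hpos' : K i u ≠ 0 := by
      intro h0
      rw [h0] at hlast
      linarith [h.start_le i, hu.1]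
    obtain ⟨k, hk⟩ := Nat.exists_eq_add_one_of_ne_zero hpos'
    have huk := (h.last i u hTu).1
    rw [hk] at hlast huk ⊢
    have hstep := h.step_le i k
    have hsk : s + max τ 0 ≤ t i k := by linarith [hu.1]
    rw [mul_assoc]
    exact h.update_le_of_neighbor_le hji.1 (by linarith) (mul_nonneg hc.le hg)
      (fun v hv l => hA v (by linarith [hv.1]) l)
      (fun v hv => hcW s A g hs hg hA hr v ⟨by linarith [hv.1], by linarith [hv.2, hu.2]⟩)

/-- Bounds on the sampled states, valid from some time on, contract by a uniform factor. -/
theorem exists_contraction (h : IsSelfTriggered L δ t K T D x) (hδ : ∀ i, δ i ≤ 1)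
    (htree : HasSpanningTreeRel (fun j i : Fin n => i ≠ j ∧ L i j < 0)) :
    ∃ q : ℝ, 0 ≤ q ∧ q < 1 ∧ ∃ τ : ℝ, 0 ≤ τ ∧ ∀ s a b : ℝ, T ≤ s →
      (∀ u, s ≤ u → ∀ j, x (t j (K j u)) j ∈ Icc a b) →
      ∃ a' b', b' - a' ≤ q * (b - a) ∧
        ∀ u, s + τ ≤ u → ∀ j, x (t j (K j u)) j ∈ Icc a' b' := by
  obtain ⟨r, hr⟩ := htree
  have hD := h.step_pos r
  choose σ hσ using fun i => h.exists_gap_of_reachable hδ (hr i)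
  choose σ' hσ' using fun i => h.neg.exists_gap_of_reachable hδ (hr i)
  set τ := ∑ i, (|σ i| + |σ' i|)
  have hle : ∀ i, |σ i| + |σ' i| ≤ τ := fun i =>
    Finset.single_le_sum (f := fun i => |σ i| + |σ' i|) (fun j _ => by positivity)
      (Finset.mem_univ i)
  have hτ0 : 0 ≤ τ := Finset.sum_nonneg fun j _ => by positivity
  choose c hc hcW using fun i => hσ i (τ + D)
  choose c' hc' hcW' using fun i => hσ' i (τ + D)
  have hne : (Finset.univ : Finset (Fin n)).Nonempty := ⟨r, Finset.mem_univ r⟩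
  obtain ⟨e, he0, he1, hec⟩ : ∃ e : ℝ, 0 < e ∧ e ≤ 1 ∧ ∀ i, e ≤ c i ∧ e ≤ c' i := by
    refine ⟨min 1 (Finset.univ.inf' hne fun i => min (c i) (c' i)), ?_, min_le_left _ _,
      fun i => ?_⟩
    · exact lt_min one_pos ((Finset.lt_inf'_iff _).2 fun i _ => lt_min (hc i) (hc' i))
    · exact le_min_iff.1 ((min_le_right _ _).trans (Finset.inf'_le _ (Finset.mem_univ i)))
  refine ⟨1 - e / 2, by linarith, by linarith, τ, hτ0, fun s a b hs hab => ?_⟩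
  have hV : 0 ≤ b - a := by
    have := hab s le_rfl r
    linarith [this.1, this.2]
  have hge : ∀ i, e * ((b - a) / 2) ≤ c i * ((b - a) / 2) ∧
      e * ((b - a) / 2) ≤ c' i * ((b - a) / 2) := fun i =>
    ⟨mul_le_mul_of_nonneg_right (hec i).1 (by linarith),
      mul_le_mul_of_nonneg_right (hec i).2 (by linarith)⟩
  have hsτ : T ≤ s + τ := by linarith
  rcases le_total (x (t r (K r (s + D))) r) (b - (b - a) / 2) with hmid | hmid
  · refine ⟨a, b - e * ((b - a) / 2), by linarith, fun u hu j =>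
      ⟨(hab u (by linarith) j).1, h.sampled_le_of_window hsτ (fun v hv i => ?_) u hu j⟩⟩
    have := hcW i s b ((b - a) / 2) hs (by linarith) (fun u hu j => (hab u hu j).2) hmid v
      ⟨by linarith [hv.1, hle i, le_abs_self (σ i), abs_nonneg (σ' i)], by linarith [hv.2]⟩
    linarith [(hge i).1]
  · refine ⟨a + e * ((b - a) / 2), b, by linarith, fun u hu j =>
      ⟨?_, (hab u (by linarith) j).2⟩⟩
    have key := h.neg.sampled_le_of_window (A := -a - e * ((b - a) / 2)) hsτ
      (fun v hv i => ?_) u hu j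
    · linarith
    have := hcW' i s (-a) ((b - a) / 2) hs (by linarith)
      (fun u hu j => neg_le_neg (hab u hu j).1) (by linarith) v
      ⟨by linarith [hv.1, hle i, le_abs_self (σ' i), abs_nonneg (σ i)], by linarith [hv.2]⟩
    linarith [(hge i).2]

theorem exists_sampled_le (h : IsSelfTriggered L δ t K T D x) :
    ∃ A, ∀ u, T ≤ u → ∀ j, x (t j (K j u)) j ≤ A := by
  refine ⟨∑ j, ∑ k ∈ Finset.range (K j (T + D) + 1), |x (t j k) j|,
    h.sampled_le_of_window le_rfl fun u hu j => ?_⟩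
  have hmem : K j u ∈ Finset.range (K j (T + D) + 1) :=
    Finset.mem_range.2 (Nat.lt_succ_of_le (h.last_mono j hu.1 hu.2))
  calc x (t j (K j u)) j ≤ |x (t j (K j u)) j| := le_abs_self _
    _ ≤ ∑ k ∈ Finset.range (K j (T + D) + 1), |x (t j k) j| :=
      Finset.single_le_sum (f := fun k => |x (t j k) j|) (fun k _ => abs_nonneg _) hmem
    _ ≤ _ := Finset.single_le_sum
      (f := fun j => ∑ k ∈ Finset.range (K j (T + D) + 1), |x (t j k) j|)
      (fun j _ => Finset.sum_nonneg fun k _ => abs_nonneg _) (Finset.mem_univ j)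

/-- Eventually all sampled states lie in an arbitrarily short interval. -/
theorem exists_sampled_mem_Icc (h : IsSelfTriggered L δ t K T D x) (hδ : ∀ i, δ i ≤ 1)
    (htree : HasSpanningTreeRel (fun j i : Fin n => i ≠ j ∧ L i j < 0)) {ε : ℝ} (hε : 0 < ε) :
    ∃ s a b, b - a < ε ∧ ∀ u, s ≤ u → ∀ j, x (t j (K j u)) j ∈ Icc a b := by
  obtain ⟨q, hq0, hq1, τ, hτ, hcontr⟩ := h.exists_contraction hδ htree
  obtain ⟨A, hA⟩ := h.exists_sampled_le
  obtain ⟨B, hB⟩ := h.neg.exists_sampled_le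
  have hiter : ∀ p : ℕ, ∃ s a b, T ≤ s ∧ b - a ≤ q ^ p * (A + B) ∧
      ∀ u, s ≤ u → ∀ j, x (t j (K j u)) j ∈ Icc a b := by
    intro p
    induction p with
    | zero =>
      exact ⟨T, -B, A, le_rfl, by linarith, fun u hu j =>
        ⟨neg_le.1 (hB u hu j), hA u hu j⟩⟩
    | succ p ih =>
      obtain ⟨s, a, b, hs, hlen, hab⟩ := ih
      obtain ⟨a', b', hlen', hab'⟩ := hcontr s a b hs hab
      refine ⟨s + τ, a', b', by linarith, hlen'.trans ?_, hab'⟩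
      rw [pow_succ', mul_assoc]
      exact mul_le_mul_of_nonneg_left hlen hq0
  have hlim : Tendsto (fun p : ℕ => q ^ p * (A + B)) atTop (𝓝 0) := by
    simpa using (tendsto_pow_atTop_nhds_zero_of_lt_one hq0 hq1).mul_const (A + B)
  obtain ⟨p, hp⟩ := (hlim.eventually_lt_const hε).exists
  obtain ⟨s, a, b, -, hlen, hab⟩ := hiter p
  exact ⟨s, a, b, hlen.trans_lt hp, hab⟩

theorem exists_tendsto (h : IsSelfTriggered L δ t K T D x) (hδ : ∀ i, δ i ≤ 1)
    (htree : HasSpanningTreeRel (fun j i : Fin n => i ≠ j ∧ L i j < 0)) :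
    ∃ xs : ℝ, ∀ i, Tendsto (fun k => x (t i k) i) atTop (𝓝 xs) := by
  have hclose : ∀ ε > 0, ∃ s, ∀ u, s ≤ u → ∀ v, s ≤ v → ∀ i j,
      dist (x (t i (K i u)) i) (x (t j (K j v)) j) < ε := by
    intro ε hε
    obtain ⟨s, a, b, hlen, hab⟩ := h.exists_sampled_mem_Icc hδ htree hε
    exact ⟨s, fun u hu v hv i j => (Real.dist_le_of_mem_Icc (hab u hu i) (hab v hv j)).trans_lt
      hlen⟩
  have ⟨r, _⟩ := htree
  obtain ⟨xs, hxs⟩ : ∃ xs, Tendsto (fun u => x (t r (K r u)) r) atTop (𝓝 xs) := by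
    refine cauchySeq_tendsto_of_complete (Metric.cauchySeq_iff.2 fun ε hε => ?_)
    obtain ⟨s, hs⟩ := hclose ε hε
    exact ⟨s, fun u hu v hv => hs u hu v hv r r⟩
  refine ⟨xs, fun i => ?_⟩
  have hi : Tendsto (fun u => x (t i (K i u)) i) atTop (𝓝 xs) := by
    refine hxs.congr_dist (Metric.tendsto_nhds.2 fun ε hε => ?_)
    obtain ⟨s, hs⟩ := hclose ε hε
    filter_upwards [eventually_ge_atTop s] with u hu
    simpa using hs u hu u hu r i
  refine (hi.comp (h.tendsto_update i)).congr' ?_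
  filter_upwards [(h.tendsto_update i).eventually_ge_atTop T] with k hk
  simp [h.last_update hk]

end IsSelfTriggered

end

/-- Lemma 2: the sampled states `x_i(t_i^k)` converge to a common
value `x*`. `K j s` plays the role of `k_j(s) = max {k : t_j^k ≤ s}`,
characterized for all `s ≥ max_i t_i^0` by the hypothesis `hK`. -/
theorem distributed_selfTriggered_sampled_states_converge
    {n : ℕ} (L : Fin n → Fin n → ℝ) (hL : IsLaplacian L)
    (htree : HasSpanningTreeRel (fun j i : Fin n => i ≠ j ∧ L i j < 0))
    (hdiag : ∀ i, 0 < L i i)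
    (δᵢ : Fin n → ℝ) (hδᵢ : ∀ i, δᵢ i ∈ Set.Ioo (0 : ℝ) (1 / 2))
    (t : Fin n → ℕ → ℝ) (hmono : ∀ i, StrictMono (t i))
    (hΔ : ∀ i k, t i (k + 1) - t i k ∈ Set.Icc (δᵢ i / L i i) ((1 - δᵢ i) / L i i))
    (x : ℝ → Fin n → ℝ) (hcont : Continuous x)
    (K : Fin n → ℝ → ℕ)
    (hK : ∀ j s, (∀ i, t i 0 ≤ s) →
      t j (K j s) ≤ s ∧ ∀ k, t j k ≤ s → k ≤ K j s)
    (hdyn : ∀ s, (∀ i, t i 0 ≤ s) → (∀ i k, s ≠ t i k) → ∀ i,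
      HasDerivAt (fun u => x u i) (-∑ j, L i j * x (t j (K j s)) j) s) :
    ∃ xs : ℝ, ∀ i, Tendsto (fun k => x (t i k) i) atTop (𝓝 xs) := by
  have hD : ∀ i, (1 - δᵢ i) / L i i ≤ ∑ j, 1 / L j j := fun i =>
    (div_le_div_of_nonneg_right (by linarith [(hδᵢ i).1]) (hdiag i).le).trans
      (Finset.single_le_sum (f := fun j => 1 / L j j)
        (fun j _ => (one_div_pos.2 (hdiag j)).le) (Finset.mem_univ i))
  have hT : ∀ i, t i 0 ≤ ∑ j, |t j 0| := fun i => (le_abs_self _).trans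
    (Finset.single_le_sum (f := fun j => |t j 0|) (fun j _ => abs_nonneg _) (Finset.mem_univ i))
  have h : IsSelfTriggered L δᵢ t K (∑ j, |t j 0|) (∑ j, 1 / L j j) x :=
    { laplacian := hL
      diag_pos := hdiag
      margin_pos := fun i => (hδᵢ i).1
      strictMono := hmono
      step_mem := hΔ
      step_le := fun i k => (hΔ i k).2.trans (hD i)
      start_le := hT
      continuous := hcont
      last := fun j s hs => hK j s fun i => (hT i).trans hs
      hasDerivAt := fun s hs => hdyn s fun i => (hT i).trans hs }
  exact h.exists_tendsto (fun i => by linarith [(hδᵢ i).2]) htree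
end

section
/- Let L ∈ ℝ^{n×n} be a graph Laplacian whose directed graph G(L) has a spanning tree and with l_ii > 0 for every i. Let 0 < ε_min < ε_max and for each agent i and each k let a scaling factor ε_i^k ∈ [ε_min, ε_max] be given, defining switching coupling weights l_ij^k := ε_i^k l_ij. For each agent i let δ_i ∈ (0, 1/2) and let t_i^0 < t_i^1 < … be its update times with Δt_i^k := t_i^{k+1} − t_i^k ∈ [δ_i/l_ii^k, (1−δ_i)/l_ii^k] for all k, and set k_j(t) = max{k : t_j^k ≤ t}. Let x : ℝ → ℝ^n be continuous and satisfy ẋ_i(t) = −∑_{j=1}^n l_ij^k x_j(t_j^{k_j(t)}) for every i, every k, and every t ∈ (t_i^k, t_i^{k+1}) that is not an update time of any agent. Then the system reaches consensus: there exists x* ∈ ℝ such that lim_{t→∞} x_i(t) = x* for every i. -/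
open Filter Topology

/-- A function whose derivative is at least `C` off a finite set grows at least with slope `C`. -/
lemma mul_sub_le_image_sub_of_le_hasDerivAt_off_finite {f : ℝ → ℝ} (hf : Continuous f) {C : ℝ}
    (F : Finset ℝ) : ∀ {a b : ℝ}, a ≤ b →
      (∀ s ∈ Set.Ioo a b, s ∉ F → ∃ f', HasDerivAt f f' s ∧ C ≤ f') →
      C * (b - a) ≤ f b - f a := by
  induction F using Finset.induction_on with
  | empty =>
    intro a b hab h
    rcases hab.eq_or_lt with rfl | hlt
    · simp
    choose! f' hf' using fun s hs => h s hs (Finset.notMem_empty s)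
    obtain ⟨c, hc, hslope⟩ := exists_hasDerivAt_eq_slope f f' hlt hf.continuousOn
      fun s hs => (hf' s hs).1
    have hC := (hf' c hc).2
    rwa [hslope, le_div_iff₀ (sub_pos.2 hlt)] at hC
  | insert p F _ ih =>
    intro a b hab h
    by_cases hp : p ∈ Set.Ioo a b
    · have h₁ := ih hp.1.le fun s hs hsF => h s ⟨hs.1, hs.2.trans hp.2⟩
        (by simp [hsF, hs.2.ne])
      have h₂ := ih hp.2.le fun s hs hsF => h s ⟨hp.1.trans hs.1, hs.2⟩
        (by simp [hsF, hs.1.ne'])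
      linarith
    · refine ih hab fun s hs hsF => h s hs ?_
      rw [Finset.mem_insert, not_or]
      exact ⟨fun hsp => hp (hsp ▸ hs), hsF⟩

lemma exists_pos_lower_bound {ι : Type*} [Finite ι] (f : ι → ℝ) (hf : ∀ i, 0 < f i) :
    ∃ d > 0, ∀ i, d ≤ f i := by
  cases isEmpty_or_nonempty ι
  · exact ⟨1, one_pos, fun i => isEmptyElim i⟩
  · obtain ⟨i, hi⟩ := Finite.exists_min f
    exact ⟨f i, hf i, hi⟩

lemma exists_pos_upper_bound {ι : Type*} [Finite ι] (f : ι → ℝ) :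
    ∃ B > 0, ∀ i, f i ≤ B := by
  obtain ⟨B, hB⟩ := (Set.finite_range f).bddAbove
  exact ⟨max B 1, by positivity, fun i => (hB ⟨i, rfl⟩).trans (le_max_left _ _)⟩

/-- Sample-and-hold Laplacian dynamics from time `T₀` on, with inter-sampling times in `[d, H]`
and normalized step sizes in `[δ, 1 - δ]`. -/
structure HeldLaplacianFlow {n : ℕ} (L : Fin n → Fin n → ℝ) (ε : Fin n → ℕ → ℝ)
    (t : Fin n → ℕ → ℝ) (K : Fin n → ℝ → ℕ) (T₀ H d δ : ℝ) (x : ℝ → Fin n → ℝ) : Prop where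
  laplacian : IsLaplacian L
  diag_pos : ∀ i, 0 < L i i
  gain_pos : ∀ i k, 0 < ε i k
  mono : ∀ i, StrictMono (t i)
  step_pos : 0 < d
  le_step : ∀ i k, d ≤ t i (k + 1) - t i k
  step_le : ∀ i k, t i (k + 1) - t i k ≤ H
  margin_pos : 0 < δ
  margin_le : ∀ i k, δ ≤ ε i k * L i i * (t i (k + 1) - t i k)
  le_margin : ∀ i k, ε i k * L i i * (t i (k + 1) - t i k) ≤ 1 - δ
  start_le : ∀ i, t i 0 ≤ T₀
  cont : Continuous x
  last_le : ∀ j s, T₀ ≤ s → t j (K j s) ≤ s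
  le_last : ∀ j s, T₀ ≤ s → ∀ k, t j k ≤ s → k ≤ K j s
  dyn : ∀ i k, ∀ s ∈ Set.Ioo (t i k) (t i (k + 1)), T₀ ≤ s → (∀ i' k', s ≠ t i' k') →
    HasDerivAt (fun u => x u i) (-∑ j, ε i k * L i j * x (t j (K j s)) j) s

namespace HeldLaplacianFlow

variable {n : ℕ} {L : Fin n → Fin n → ℝ} {ε : Fin n → ℕ → ℝ} {t : Fin n → ℕ → ℝ}
  {K : Fin n → ℝ → ℕ} {T₀ H d δ : ℝ} {x : ℝ → Fin n → ℝ}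

lemma neg (h : HeldLaplacianFlow L ε t K T₀ H d δ x) :
    HeldLaplacianFlow L ε t K T₀ H d δ (fun u i => -x u i) where
  __ := h
  cont := h.cont.neg
  dyn i k s hs hT hne := by
    simp only [mul_neg, Finset.sum_neg_distrib]
    exact (h.dyn i k s hs hT hne).neg

lemma lt_next (h : HeldLaplacianFlow L ε t K T₀ H d δ x) (j : Fin n) {s : ℝ} (hs : T₀ ≤ s) :
    s < t j (K j s + 1) := by
  by_contra! hle
  have := h.le_last j s hs _ hle
  omega

lemma sub_lt_last (h : HeldLaplacianFlow L ε t K T₀ H d δ x) (j : Fin n) {s : ℝ} (hs : T₀ ≤ s) :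
    s - H < t j (K j s) := by
  have := h.lt_next j hs
  have := h.step_le j (K j s)
  linarith

lemma last_eq (h : HeldLaplacianFlow L ε t K T₀ H d δ x) {i : Fin n} {k : ℕ} {s : ℝ}
    (hs : T₀ ≤ s) (h₁ : t i k ≤ s) (h₂ : s < t i (k + 1)) : K i s = k := by
  refine le_antisymm ?_ (h.le_last i s hs k h₁)
  have := (h.mono i).lt_iff_lt.1 ((h.last_le i s hs).trans_lt h₂)
  omega

lemma horizon_pos (h : HeldLaplacianFlow L ε t K T₀ H d δ x) (i : Fin n) : 0 < H :=
  h.step_pos.trans_le ((h.le_step i 0).trans (h.step_le i 0))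

lemma exists_pred (h : HeldLaplacianFlow L ε t K T₀ H d δ x) {i : Fin n} {k : ℕ}
    (hk : T₀ < t i k) : ∃ k', k = k' + 1 ∧ t i k - H ≤ t i k' := by
  obtain _ | k := k
  · exact absurd (h.start_le i) hk.not_ge
  · exact ⟨k, rfl, by linarith [h.step_le i k]⟩

lemma finite_samples (h : HeldLaplacianFlow L ε t K T₀ H d δ x) {b : ℝ} (hb : T₀ ≤ b) :
    {s | s ≤ b ∧ ∃ i k, s = t i k}.Finite := by
  refine (Set.finite_iUnion fun i : Fin n => (Set.finite_Iic (K i b)).image (t i)).subset ?_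
  rintro _ ⟨hs, i, k, rfl⟩
  exact Set.mem_iUnion.2 ⟨i, k, h.le_last i b hb k hs, rfl⟩

/-- If the held values of the neighbours exceed `m` by a weighted total of at least `W`, then
agent `i` stays above the corresponding convex combination. -/
lemma lower_bound (h : HeldLaplacianFlow L ε t K T₀ H d δ x) {i : Fin n} {k : ℕ} {m W u : ℝ}
    (hk : T₀ ≤ t i k) (hu : u ∈ Set.Icc (t i k) (t i (k + 1)))
    (hW : ∀ s ∈ Set.Ioo (t i k) (t i (k + 1)),
      W ≤ ∑ j ∈ Finset.univ.erase i, -L i j * (x (t j (K j s)) j - m)) :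
    (1 - ε i k * L i i * (u - t i k)) * (x (t i k) i - m) + ε i k * (u - t i k) * W
      ≤ x u i - m := by
  have hslope := mul_sub_le_image_sub_of_le_hasDerivAt_off_finite
    (f := fun u => x u i) ((continuous_apply i).comp h.cont)
    (C := ε i k * (W - L i i * (x (t i k) i - m)))
    (h.finite_samples (hk.trans hu.1)).toFinset hu.1 ?_
  · linarith
  intro s hs hsF
  have hs' : s ∈ Set.Ioo (t i k) (t i (k + 1)) := ⟨hs.1, hs.2.trans_le hu.2⟩
  have hT : T₀ ≤ s := hk.trans hs.1.le
  refine ⟨_, h.dyn i k s hs' hT fun i' k' he => hsF ?_, ?_⟩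
  · rw [Set.Finite.mem_toFinset]
    exact ⟨hs.2.le, i', k', he⟩
  · have hlast := h.last_eq hT hs'.1.le hs'.2
    have hsum : -∑ j, ε i k * L i j * x (t j (K j s)) j =
        ε i k * ∑ j, -L i j * (x (t j (K j s)) j - m) := by
      have hshift : ∑ j, -L i j * (x (t j (K j s)) j - m) =
          -∑ j, L i j * x (t j (K j s)) j := by
        simp only [mul_sub, Finset.sum_sub_distrib, ← Finset.sum_mul, Finset.sum_neg_distrib,
          h.laplacian.2 i, neg_mul]
        simp
      rw [hshift, mul_neg, Finset.mul_sum]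
      simp only [mul_assoc]
    rw [hsum, ← Finset.add_sum_erase _ _ (Finset.mem_univ i), hlast]
    refine mul_le_mul_of_nonneg_left ?_ (h.gain_pos i k).le
    linarith [hW s hs']

lemma margin_le_one_sub (h : HeldLaplacianFlow L ε t K T₀ H d δ x) {i : Fin n} {k : ℕ} {u : ℝ}
    (hu : u ∈ Set.Icc (t i k) (t i (k + 1))) : δ ≤ 1 - ε i k * L i i * (u - t i k) := by
  have := mul_le_mul_of_nonneg_left (sub_le_sub_right hu.2 (t i k))
    (mul_pos (h.gain_pos i k) (h.diag_pos i)).le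
  linarith [h.le_margin i k]

lemma contract_le (h : HeldLaplacianFlow L ε t K T₀ H d δ x) {i : Fin n} {k : ℕ} {m u : ℝ}
    (hk : T₀ ≤ t i k) (hu : u ∈ Set.Icc (t i k) (t i (k + 1))) (hm : m ≤ x (t i k) i)
    (hheld : ∀ s ∈ Set.Ioo (t i k) (t i (k + 1)), ∀ j, m ≤ x (t j (K j s)) j) :
    δ * (x (t i k) i - m) ≤ x u i - m := by
  have hlow := h.lower_bound (m := m) (W := 0) hk hu fun s hs =>
    Finset.sum_nonneg fun j hj => mul_nonneg
      (neg_nonneg.2 (h.laplacian.1 i j (Finset.ne_of_mem_erase hj).symm))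
      (sub_nonneg.2 (hheld s hs j))
  have := mul_le_mul_of_nonneg_right (h.margin_le_one_sub hu) (sub_nonneg.2 hm)
  linarith

lemma le_of_held (h : HeldLaplacianFlow L ε t K T₀ H d δ x) {i : Fin n} {k : ℕ} {m u : ℝ}
    (hk : T₀ ≤ t i k) (hu : u ∈ Set.Icc (t i k) (t i (k + 1))) (hm : m ≤ x (t i k) i)
    (hheld : ∀ s ∈ Set.Ioo (t i k) (t i (k + 1)), ∀ j, m ≤ x (t j (K j s)) j) :
    m ≤ x u i := by
  have := h.contract_le hk hu hm hheld
  have := mul_nonneg h.margin_pos.le (sub_nonneg.2 hm)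
  linarith

lemma gain_from_neighbour (h : HeldLaplacianFlow L ε t K T₀ H d δ x) {i j : Fin n} {k : ℕ}
    {m c : ℝ} (hij : i ≠ j) (hc : 0 ≤ c) (hk : T₀ ≤ t i k) (hm : m ≤ x (t i k) i)
    (hheld : ∀ s ∈ Set.Ioo (t i k) (t i (k + 1)), ∀ j, m ≤ x (t j (K j s)) j)
    (hj : ∀ s ∈ Set.Ioo (t i k) (t i (k + 1)), m + c ≤ x (t j (K j s)) j) :
    m + δ * (-L i j / L i i) * c ≤ x (t i (k + 1)) i := by
  have hw : 0 ≤ -L i j := neg_nonneg.2 (h.laplacian.1 i j hij)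
  have hu : t i (k + 1) ∈ Set.Icc (t i k) (t i (k + 1)) := ⟨(h.mono i k.lt_succ_self).le, le_rfl⟩
  have hlow := h.lower_bound (m := m) (W := -L i j * c) hk hu fun s hs => by
    refine (mul_le_mul_of_nonneg_left (le_sub_iff_add_le'.2 (hj s hs)) hw).trans ?_
    exact Finset.single_le_sum
      (f := fun j => -L i j * (x (t j (K j s)) j - m))
      (fun j hj => mul_nonneg
        (neg_nonneg.2 (h.laplacian.1 i j (Finset.ne_of_mem_erase hj).symm))
        (sub_nonneg.2 (hheld s hs j)))
      (Finset.mem_erase.2 ⟨hij.symm, Finset.mem_univ j⟩)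
  have h₁ := mul_nonneg (h.margin_pos.le.trans (h.margin_le_one_sub hu)) (sub_nonneg.2 hm)
  have h₂ := mul_le_mul_of_nonneg_right (h.margin_le i k)
    (mul_nonneg (div_nonneg hw (h.diag_pos i).le) hc)
  have h₃ : ε i k * L i i * (t i (k + 1) - t i k) * (-L i j / L i i * c) =
      ε i k * (t i (k + 1) - t i k) * (-L i j * c) := by
    have := (h.diag_pos i).ne'
    field_simp
  linarith

/-- Once all samples over a window of length `2 * H` are at least `m`, all later ones are. -/
lemma le_samples_of_window (h : HeldLaplacianFlow L ε t K T₀ H d δ x) {T m : ℝ} (hT : T₀ ≤ T)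
    (hwin : ∀ j k, T ≤ t j k → t j k ≤ T + 2 * H → m ≤ x (t j k) j) :
    ∀ j k, T ≤ t j k → m ≤ x (t j k) j := by
  intro i k hk
  induction hN : ∑ j, K j (t i k) using Nat.strong_induction_on generalizing i k with
  | _ N ih =>
    subst hN
    by_cases hle : t i k ≤ T + 2 * H
    · exact hwin i k hk hle
    have hH := h.horizon_pos i
    obtain ⟨k, rfl, hpred⟩ := h.exists_pred (i := i) (k := k) (by linarith)
    have hearlier : ∀ j l, T ≤ t j l → t j l < t i (k + 1) → m ≤ x (t j l) j := by
      intro j l hl hlt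
      refine ih _ (Finset.sum_lt_sum (fun q _ => ?_) ⟨i, Finset.mem_univ i, ?_⟩) j l hl rfl
      · exact h.le_last q _ (hT.trans hk) _
          ((h.last_le q _ (hT.trans hl)).trans hlt.le)
      · have h₁ := (h.mono i).lt_iff_lt.1 ((h.last_le i _ (hT.trans hl)).trans_lt hlt)
        exact h₁.trans_le (h.le_last i _ (hT.trans hk) _ le_rfl)
    have hstep := h.mono i k.lt_succ_self
    refine h.le_of_held (by linarith) ⟨hstep.le, le_rfl⟩ (hearlier i k (by linarith) hstep) ?_
    intro s hs j
    have hTs : T₀ ≤ s := by linarith [hs.1]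
    exact hearlier j _ (by linarith [h.sub_lt_last j hTs, hs.1])
      ((h.last_le j s hTs).trans_lt hs.2)

lemma held_ge (h : HeldLaplacianFlow L ε t K T₀ H d δ x) {T m s : ℝ} (hT : T₀ ≤ T)
    (hm : ∀ j k, T ≤ t j k → m ≤ x (t j k) j) (hs : T + H ≤ s) (j : Fin n) :
    m ≤ x (t j (K j s)) j := by
  have := h.horizon_pos j
  exact hm j _ (by linarith [h.sub_lt_last j (s := s) (by linarith)])

/-- A surplus of agent `r` over a lower bound `m` reaches every agent reachable from `r`, with a
loss factor and a delay that depend on the network only. -/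
lemma exists_propagation (h : HeldLaplacianFlow L ε t K T₀ H d δ x) {r v : Fin n}
    (hrv : Relation.ReflTransGen (fun j i : Fin n => i ≠ j ∧ L i j < 0) r v) :
    ∃ κ > 0, ∃ lag ≥ 0, ∀ T m c A B : ℝ, T₀ ≤ T → 0 ≤ c → T ≤ A →
      (∀ j k, T ≤ t j k → m ≤ x (t j k) j) →
      (∀ k, A ≤ t r k → t r k ≤ B → m + c ≤ x (t r k) r) →
      ∀ k, A + lag ≤ t v k → t v k ≤ B → m + κ * c ≤ x (t v k) v := by
  induction hrv with
  | refl =>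
    refine ⟨1, one_pos, 0, le_rfl, fun T m c A B _ _ _ _ hr k hA hB => ?_⟩
    simpa using hr k (by simpa using hA) hB
  | @tail j i _ hji ih =>
    obtain ⟨κ, hκ, lag, hlag, ih⟩ := ih
    have hH := h.horizon_pos i
    refine ⟨δ * (-L i j / L i i) * κ,
      mul_pos (mul_pos h.margin_pos (div_pos (neg_pos.2 hji.2) (h.diag_pos i))) hκ,
      lag + 2 * H, by positivity, fun T m c A B hT hc hTA hm hr k hA hB => ?_⟩
    obtain ⟨k, rfl, hpred⟩ := h.exists_pred (i := i) (k := k) (by linarith)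
    rw [mul_assoc]
    refine h.gain_from_neighbour hji.1 (mul_nonneg hκ.le hc) (by linarith)
      (hm i k (by linarith)) (fun s hs q => h.held_ge hT hm (by linarith [hs.1]) q)
      fun s hs => ?_
    have hTs : T₀ ≤ s := by linarith [hs.1]
    exact ih T m c A B hT hc hTA hm hr _ (by linarith [h.sub_lt_last j hTs, hs.1])
      (((h.last_le j s hTs).trans hs.2.le).trans hB)

lemma surplus_decay (h : HeldLaplacianFlow L ε t K T₀ H d δ x) {T m c : ℝ} {r : Fin n} {k : ℕ}
    (hT : T₀ ≤ T) (hm : ∀ j k, T ≤ t j k → m ≤ x (t j k) j) (hk : T + H ≤ t r k)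
    (hc : m + c ≤ x (t r k) r) (p : ℕ) :
    t r k + p * d ≤ t r (k + p) ∧ m + δ ^ p * c ≤ x (t r (k + p)) r := by
  have hH := h.horizon_pos r
  induction p with
  | zero => simpa using hc
  | succ p ih =>
    obtain ⟨htime, hval⟩ := ih
    have hd := h.le_step r (k + p)
    have hpd : 0 ≤ p * d := mul_nonneg p.cast_nonneg h.step_pos.le
    refine ⟨by push_cast; rw [← add_assoc]; linarith, ?_⟩
    have hstep := h.contract_le (i := r) (k := k + p) (m := m) (by linarith)
      ⟨(h.mono r (k + p).lt_succ_self).le, le_rfl⟩ (hm r _ (by linarith))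
      fun s hs j => h.held_ge hT hm (by linarith [hs.1]) j
    have := mul_le_mul_of_nonneg_left (le_sub_iff_add_le'.2 hval) h.margin_pos.le
    rw [← add_assoc k, pow_succ']
    linarith

lemma margin_le_one (h : HeldLaplacianFlow L ε t K T₀ H d δ x) (i : Fin n) : δ ≤ 1 := by
  linarith [h.margin_le i 0, h.le_margin i 0, h.margin_pos]

/-- A surplus of the root eventually raises the lower bound of all samples by a fixed fraction. -/
lemma exists_uniform_gain (h : HeldLaplacianFlow L ε t K T₀ H d δ x) {r : Fin n}
    (hr : ∀ v, Relation.ReflTransGen (fun j i : Fin n => i ≠ j ∧ L i j < 0) r v) :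
    ∃ κ > 0, ∀ T m c k, T₀ ≤ T → 0 ≤ c → (∀ j k, T ≤ t j k → m ≤ x (t j k) j) →
      T + H ≤ t r k → m + c ≤ x (t r k) r →
      ∃ T' ≥ T₀, ∀ j k, T' ≤ t j k → m + κ * c ≤ x (t j k) j := by
  choose κ hκ lag hlag hprop using fun v => h.exists_propagation (hr v)
  obtain ⟨κ₀, hκ₀, hκ₀le⟩ := exists_pos_lower_bound κ hκ
  obtain ⟨D, hD, hlagD⟩ := exists_pos_upper_bound lag
  have hH := h.horizon_pos r
  have hδ := h.margin_pos
  obtain ⟨N, hN⟩ := exists_nat_gt ((D + 2 * H) / d)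
  rw [div_lt_iff₀ h.step_pos] at hN
  refine ⟨κ₀ * δ ^ N, by positivity, fun T m c k hT hc hm hk hroot => ?_⟩
  refine ⟨t r k + D, by linarith, h.le_samples_of_window (by linarith) fun v l hl hl' => ?_⟩
  have hroot' : ∀ l, t r k ≤ t r l → t r l ≤ t r k + (D + 2 * H) →
      m + δ ^ N * c ≤ x (t r l) r := by
    intro l hl hl'
    obtain ⟨p, rfl⟩ := Nat.exists_eq_add_of_le ((h.mono r).le_iff_le.1 hl)
    obtain ⟨htime, hval⟩ := h.surplus_decay hT hm hk hroot p
    have hpN : p ≤ N := by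
      have : (p : ℝ) * d < N * d := by linarith
      exact_mod_cast (lt_of_mul_lt_mul_right this h.step_pos.le).le
    have := mul_le_mul_of_nonneg_right
      (pow_le_pow_of_le_one hδ.le (h.margin_le_one r) hpN) hc
    linarith
  have hv := hprop v T m (δ ^ N * c) (t r k) (t r k + (D + 2 * H)) hT (by positivity)
    (by linarith) hm hroot' l (by linarith [hlagD v]) (by linarith)
  have := mul_le_mul_of_nonneg_right (hκ₀le v) (show 0 ≤ δ ^ N * c by positivity)
  linarith

lemma exists_lower_bound (h : HeldLaplacianFlow L ε t K T₀ H d δ x) :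
    ∃ m, ∃ T ≥ T₀, ∀ j k, T ≤ t j k → m ≤ x (t j k) j := by
  have hbdd : ∀ j, ∃ m, ∀ s ∈ Set.Icc T₀ (T₀ + 2 * H), m ≤ x s j := fun j => by
    obtain ⟨m, hm⟩ := (isCompact_Icc (a := T₀) (b := T₀ + 2 * H)).bddBelow_image
      ((continuous_apply j).comp h.cont).continuousOn
    exact ⟨m, fun s hs => hm ⟨s, hs, rfl⟩⟩
  choose m hm using hbdd
  obtain ⟨m₀, hm₀⟩ := (Set.finite_range m).bddBelow
  exact ⟨m₀, T₀, le_rfl, h.le_samples_of_window le_rfl fun j k h₁ h₂ =>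
    (hm₀ ⟨j, rfl⟩).trans (hm j _ ⟨h₁, h₂⟩)⟩

lemma exists_sample_ge (h : HeldLaplacianFlow L ε t K T₀ H d δ x) (i : Fin n) (T : ℝ) :
    ∃ k, T ≤ t i k :=
  ⟨_, ((le_max_left T T₀).trans_lt (h.lt_next i (le_max_right T T₀))).le⟩

lemma eventually_ge (h : HeldLaplacianFlow L ε t K T₀ H d δ x) {T m : ℝ} (hT : T₀ ≤ T)
    (hm : ∀ j k, T ≤ t j k → m ≤ x (t j k) j) (i : Fin n) :
    ∀ᶠ u in atTop, m ≤ x u i := by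
  have hH := h.horizon_pos i
  filter_upwards [eventually_ge_atTop (T + 2 * H)] with u hu
  have hTu : T₀ ≤ u := by linarith
  have hlast := h.sub_lt_last i hTu
  exact h.le_of_held (by linarith) ⟨h.last_le i u hTu, (h.lt_next i hTu).le⟩
    (hm i _ (by linarith)) fun s hs j => h.held_ge hT hm (by linarith [hs.1]) j

theorem consensus (h : HeldLaplacianFlow L ε t K T₀ H d δ x)
    (htree : HasSpanningTreeRel (fun j i : Fin n => i ≠ j ∧ L i j < 0)) :
    ∃ xs : ℝ, ∀ i, Tendsto (fun u => x u i) atTop (𝓝 xs) := by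
  obtain ⟨r, hr⟩ := htree
  have hH := h.horizon_pos r
  let lo : Set ℝ := {m | ∃ T ≥ T₀, ∀ j k, T ≤ t j k → m ≤ x (t j k) j}
  let up : Set ℝ := {M | ∃ T ≥ T₀, ∀ j k, T ≤ t j k → x (t j k) j ≤ M}
  have hlo : lo.Nonempty := h.exists_lower_bound
  have hup : up.Nonempty := by
    obtain ⟨m, T, hT, hm⟩ := h.neg.exists_lower_bound
    exact ⟨-m, T, hT, fun j k hk => le_neg.1 (hm j k hk)⟩
  have hle : ∀ m ∈ lo, ∀ M ∈ up, m ≤ M := by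
    rintro m ⟨T, _, hm⟩ M ⟨T', _, hM⟩
    obtain ⟨k, hk⟩ := h.exists_sample_ge r (max T T')
    exact (hm r k (le_of_max_le_left hk)).trans (hM r k (le_of_max_le_right hk))
  have hbelow : BddAbove lo := hup.imp fun M hM m hm => hle m hm M hM
  have habove : BddBelow up := hlo.imp fun m hm M hM => hle m hm M hM
  have hgap : sSup lo = sInf up := by
    refine le_antisymm (csSup_le hlo fun m hm => le_csInf hup (hle m hm)) ?_
    by_contra! hlt
    set D := sInf up - sSup lo with hD
    have hDpos : 0 < D := sub_pos.2 hlt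
    obtain ⟨κ₁, hκ₁, hgain₁⟩ := h.exists_uniform_gain hr
    obtain ⟨κ₂, hκ₂, hgain₂⟩ := h.neg.exists_uniform_gain hr
    set η := min κ₁ κ₂ * (D / 4)
    have hη : 0 < η := by positivity
    have hη₁ : η ≤ κ₁ * (D / 4) :=
      mul_le_mul_of_nonneg_right (min_le_left _ _) (by positivity)
    have hη₂ : η ≤ κ₂ * (D / 4) :=
      mul_le_mul_of_nonneg_right (min_le_right _ _) (by positivity)
    obtain ⟨m, ⟨T, hT, hm⟩, hmη⟩ := exists_lt_of_lt_csSup hlo (sub_lt_self (sSup lo) hη)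
    obtain ⟨M, ⟨T', hT', hM⟩, hMη⟩ := exists_lt_of_csInf_lt hup
      (lt_add_of_pos_right (sInf up) hη)
    obtain ⟨k, hk⟩ := h.exists_sample_ge r (max T T' + H)
    have hkT : T + H ≤ t r k := by linarith [le_max_left T T']
    have hkT' : T' + H ≤ t r k := by linarith [le_max_right T T']
    have hm_le : m ≤ sSup lo := le_csSup hbelow ⟨T, hT, hm⟩
    have hM_ge : sInf up ≤ M := csInf_le habove ⟨T', hT', hM⟩
    rcases le_total (sSup lo + D / 2) (x (t r k) r) with hx | hx
    · obtain ⟨S, hS, hSm⟩ := hgain₁ T m (D / 2) k hT (by positivity) hm hkT (by linarith)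
      have : m + κ₁ * (D / 2) ≤ sSup lo := le_csSup hbelow ⟨S, hS, hSm⟩
      linarith
    · obtain ⟨S, hS, hSM⟩ := hgain₂ T' (-M) (D / 2) k hT' (by positivity)
        (fun j k hk => neg_le_neg (hM j k hk)) hkT' (by linarith)
      have : sInf up ≤ M - κ₂ * (D / 2) :=
        csInf_le habove ⟨S, hS, fun j k hk => by linarith [hSM j k hk]⟩
      linarith
  refine ⟨sSup lo, fun i => tendsto_order.2 ⟨fun a ha => ?_, fun b hb => ?_⟩⟩
  · obtain ⟨m, ⟨T, hT, hm⟩, ham⟩ := exists_lt_of_lt_csSup hlo ha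
    filter_upwards [h.eventually_ge hT hm i] with u hu using ham.trans_le hu
  · rw [hgap] at hb
    obtain ⟨M, ⟨T, hT, hM⟩, hMb⟩ := exists_lt_of_csInf_lt hup hb
    filter_upwards [h.neg.eventually_ge (m := -M) hT (fun j k hk => neg_le_neg (hM j k hk)) i]
      with u hu using (neg_le_neg_iff.1 hu).trans_lt hMb

end HeldLaplacianFlow

/-- Theorem 4: distributed self-triggered consensus with
switching topologies given by bounded scaling factors `ε_i^k`, so that
`l_ij^k = ε_i^k l_ij`. `K j s` plays the role of `k_j(s) = max {k : t_j^k ≤ s}`,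
characterized for all `s ≥ max_i t_i^0` by the hypothesis `hK`. -/
theorem distributed_selfTriggered_consensus_scaled_switching
    {n : ℕ} (L : Fin n → Fin n → ℝ) (hL : IsLaplacian L)
    (htree : HasSpanningTreeRel (fun j i : Fin n => i ≠ j ∧ L i j < 0))
    (hdiag : ∀ i, 0 < L i i)
    (εmin εmax : ℝ) (hεmin : 0 < εmin) (hεlt : εmin < εmax)
    (ε : Fin n → ℕ → ℝ) (hε : ∀ i k, ε i k ∈ Set.Icc εmin εmax)
    (δᵢ : Fin n → ℝ) (hδᵢ : ∀ i, δᵢ i ∈ Set.Ioo (0 : ℝ) (1 / 2))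
    (t : Fin n → ℕ → ℝ) (hmono : ∀ i, StrictMono (t i))
    (hΔ : ∀ i k, t i (k + 1) - t i k ∈
      Set.Icc (δᵢ i / (ε i k * L i i)) ((1 - δᵢ i) / (ε i k * L i i)))
    (x : ℝ → Fin n → ℝ) (hcont : Continuous x)
    (K : Fin n → ℝ → ℕ)
    (hK : ∀ j s, (∀ i, t i 0 ≤ s) →
      t j (K j s) ≤ s ∧ ∀ k, t j k ≤ s → k ≤ K j s)
    (hdyn : ∀ i k, ∀ s ∈ Set.Ioo (t i k) (t i (k + 1)),
      (∀ i', t i' 0 ≤ s) → (∀ i' k', s ≠ t i' k') →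
      HasDerivAt (fun u => x u i) (-∑ j, ε i k * L i j * x (t j (K j s)) j) s) :
    ∃ xs : ℝ, ∀ i, Tendsto (fun u => x u i) atTop (𝓝 xs) := by
  obtain ⟨T₀, -, hT₀⟩ := exists_pos_upper_bound fun i => t i 0
  obtain ⟨H, -, hH⟩ := exists_pos_upper_bound fun i => (1 - δᵢ i) / (εmin * L i i)
  obtain ⟨d, hd, hdle⟩ := exists_pos_lower_bound (fun i => δᵢ i / (εmax * L i i))
    fun i => div_pos (hδᵢ i).1 (mul_pos (hεmin.trans hεlt) (hdiag i))
  obtain ⟨δ, hδ, hδle⟩ := exists_pos_lower_bound δᵢ fun i => (hδᵢ i).1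
  have hεpos : ∀ i k, 0 < ε i k := fun i k => hεmin.trans_le (hε i k).1
  have hgain : ∀ i k, 0 < ε i k * L i i := fun i k => mul_pos (hεpos i k) (hdiag i)
  have hflow : HeldLaplacianFlow L ε t K T₀ H d δ x :=
    { laplacian := hL
      diag_pos := hdiag
      gain_pos := hεpos
      mono := hmono
      step_pos := hd
      le_step := fun i k => (hdle i).trans <| (div_le_div_of_nonneg_left (hδᵢ i).1.le (hgain i k)
        (mul_le_mul_of_nonneg_right (hε i k).2 (hdiag i).le)).trans (hΔ i k).1
      step_le := fun i k => (hΔ i k).2.trans <| (div_le_div_of_nonneg_left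
        (by linarith [(hδᵢ i).2]) (mul_pos hεmin (hdiag i))
        (mul_le_mul_of_nonneg_right (hε i k).1 (hdiag i).le)).trans (hH i)
      margin_pos := hδ
      margin_le := fun i k => (hδle i).trans ((div_le_iff₀' (hgain i k)).1 (hΔ i k).1)
      le_margin := fun i k => ((le_div_iff₀' (hgain i k)).1 (hΔ i k).2).trans
        (by linarith [hδle i])
      start_le := hT₀
      cont := hcont
      last_le := fun j s hs => (hK j s fun i => (hT₀ i).trans hs).1
      le_last := fun j s hs => (hK j s fun i => (hT₀ i).trans hs).2
      dyn := fun i k s hs hTs => hdyn i k s hs fun i' => (hT₀ i').trans hTs }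
  exact hflow.consensus htree
end
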